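/- arXiv:1011.0982 — 6 statements merged into one kernel-verified Lean document; each statement's English description precedes it below -/
import Mathlib

section
/- Let p be an odd prime and (Q,·,\,1) a finite commutative automorphic loop whose order is a power of p. Define subsets of Q recursively by Z_0 := {1} and Z_{k+1} := {a ∈ Q : for all x,y ∈ Q there exists t ∈ Z_k with L_{x,y}(a) = a·t}. Then Q is centrally nilpotent: there exists n ≥ 0 with Z_n = Q. In particular, if |Q| > 1 there exists a ≠ 1 with L_{x,y}(a) = a for all x,y ∈ Q (the center of Q is nontrivial). -/
/-- A subgroup that is maximal among the `p`-subgroups normalized by an involution `J` contains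
every `p`-element normalizing it whose `J`-conjugate stays in the generated subgroup. -/
theorem Subgroup.mem_of_maximal_invariant {G : Type*} [Group G] {p : ℕ} {J : G}
    {P : Subgroup G}
    (hP : Maximal (fun S : Subgroup G => IsPGroup p S ∧ ∀ s ∈ S, J * s * J ∈ S) P) (hJ : J * J = 1)
    {g : G} (hg : IsPGroup p (Subgroup.zpowers g)) (hgP : g ∈ Subgroup.normalizer (P : Set G))
    (hJg : J * g * J ∈ P ⊔ Subgroup.zpowers g) : g ∈ P := by
  have hle : P ≤ P ⊔ Subgroup.zpowers g := le_sup_left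
  have hS : IsPGroup p (P ⊔ Subgroup.zpowers g : Subgroup G) :=
    hP.prop.1.to_sup_of_normal_left' hg ((Subgroup.zpowers_le).2 hgP)
  have hinv : ∀ s ∈ P ⊔ Subgroup.zpowers g, J * s * J ∈ P ⊔ Subgroup.zpowers g := by
    have hJ' : J⁻¹ = J := inv_eq_of_mul_eq_one_left hJ
    have h1 : P ⊔ Subgroup.zpowers g ≤
        (P ⊔ Subgroup.zpowers g).comap (MulAut.conj J).toMonoidHom := by
      refine sup_le (fun s hs => ?_) ((Subgroup.zpowers_le).2 ?_)
      · simpa [hJ'] using hle (hP.prop.2 s hs)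
      · simpa [hJ'] using hJg
    intro s hs
    simpa [hJ'] using h1 hs
  exact hP.le_of_ge ⟨hS, hinv⟩ hle (le_sup_right (a := P) (Subgroup.mem_zpowers g))

/-- If every commutator with an involution `J` is a `p`-element, then `J` normalizes a Sylow
`p`-subgroup. -/
theorem Sylow.exists_invariant_of_involution {G : Type*} [Group G] [Finite G] {p : ℕ}
    [Fact p.Prime] {J : G} (hJ : J * J = 1)
    (hp : ∀ g : G, IsPGroup p (Subgroup.zpowers (g * J * g⁻¹ * J))) :
    ∃ P : Sylow p G, ∀ s ∈ P, J * s * J ∈ P := by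
  have hJ' : J⁻¹ = J := inv_eq_of_mul_eq_one_left hJ
  obtain ⟨P, hP⟩ : ∃ P, Maximal
      (fun S : Subgroup G => IsPGroup p S ∧ ∀ s ∈ S, J * s * J ∈ S) P := by
    refine Set.Finite.exists_maximal (Set.toFinite _) ⟨⊥, IsPGroup.of_bot, ?_⟩
    simp [hJ]
  obtain ⟨S, hPS⟩ := hP.prop.1.exists_le_sylow
  suffices h : P = S from ⟨S, fun s hs => by
    have hs' : s ∈ P := h ▸ hs
    exact hPS (hP.prop.2 s hs')⟩
  by_contra hne
  have : Group.IsNilpotent S := S.2.isNilpotent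
  have hlt : P.subgroupOf S < ⊤ := by
    rw [lt_top_iff_ne_top, Ne, Subgroup.subgroupOf_eq_top]
    exact fun h => hne (le_antisymm hPS h)
  obtain ⟨g, hgN, hgP⟩ := SetLike.exists_of_lt
    (Group.normalizerCondition_of_isNilpotent _ hlt)
  rw [Subgroup.mem_subgroupOf] at hgP
  have hgN' : (g : G) ∈ Subgroup.normalizer (P : Set G) := by
    refine Subgroup.mem_normalizer_fintype fun x hx => ?_
    have := (Subgroup.mem_normalizer_iff.1 hgN ⟨x, hPS hx⟩).1
      (by simpa [Subgroup.mem_subgroupOf] using hx)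
    simpa [Subgroup.mem_subgroupOf] using this
  have hJN : J ∈ Subgroup.normalizer (P : Set G) := by
    refine Subgroup.mem_normalizer_fintype fun x hx => ?_
    simpa [hJ'] using hP.prop.2 x hx
  have hc : (g : G) * J * (g : G)⁻¹ * J ∈ P := by
    refine Subgroup.mem_of_maximal_invariant hP hJ (hp g) ?_ ?_
    · exact mul_mem (mul_mem (mul_mem hgN' hJN) (inv_mem hgN')) hJN
    · refine le_sup_right (a := P) ?_
      have : J * ((g : G) * J * (g : G)⁻¹ * J) * J = ((g : G) * J * (g : G)⁻¹ * J)⁻¹ := by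
        simp [mul_assoc, hJ, hJ']
      rw [this]
      exact inv_mem (Subgroup.mem_zpowers _)
  refine hgP (Subgroup.mem_of_maximal_invariant hP hJ
    (S.2.to_le ((Subgroup.zpowers_le).2 g.2)) hgN' ?_)
  have h1 : J * (g : G) * J = ((g : G) * J * (g : G)⁻¹ * J)⁻¹ * (g * (J * J)) := by
    simp only [mul_inv_rev, hJ', inv_inv, hJ]; group
  rw [h1, hJ, mul_one]
  exact mul_mem (inv_mem (le_sup_left (b := Subgroup.zpowers (g : G)) hc))
    (le_sup_right (a := P) (Subgroup.mem_zpowers _))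

/-- A Sylow `p`-subgroup of a transitive group of degree a power of `p` is transitive. -/
theorem Sylow.exists_smul_eq_of_card_eq_pow {G α : Type*} [Group G] [Finite G] [MulAction G α]
    [MulAction.IsPretransitive G α] {p m : ℕ} [Fact p.Prime] (hα : Nat.card α = p ^ m)
    (P : Sylow p G) (a b : α) : ∃ s ∈ P, s • a = b := by
  have hp : p.Prime := Fact.out
  set H := MulAction.stabilizer G a
  have hH : H.index = p ^ m := by rw [MulAction.index_stabilizer_of_transitive, hα]
  have hcop : (p ^ m).Coprime (P : Subgroup G).index :=
    Nat.Coprime.pow_left _ ((Nat.Prime.coprime_iff_not_dvd hp).2 P.not_dvd_index)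
  have hdvd : p ^ m ∣ H.relIndex P := by
    refine hcop.dvd_of_dvd_mul_right ?_
    rw [← hH, ← Subgroup.inf_relIndex_right, Subgroup.relIndex_mul_index inf_le_right]
    exact Subgroup.index_dvd_of_le inf_le_left
  have horb : H.relIndex P = (MulAction.orbit P a).ncard := by
    rw [← MulAction.index_stabilizer]
    rfl
  have : Finite α := Nat.finite_of_card_ne_zero (by rw [hα]; exact pow_ne_zero _ hp.ne_zero)
  have hpos : 0 < (MulAction.orbit P a).ncard :=
    (Set.ncard_pos).2 ⟨a, MulAction.mem_orbit_self a⟩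
  have huniv : MulAction.orbit P a = Set.univ := by
    refine Set.eq_of_subset_of_ncard_le (Set.subset_univ _) ?_
    rw [Set.ncard_univ, hα, ← horb]
    exact Nat.le_of_dvd (horb ▸ hpos) hdvd
  obtain ⟨s, hs⟩ : b ∈ MulAction.orbit P a := huniv ▸ Set.mem_univ b
  exact ⟨s, s.2, hs⟩

/-- In a transitive group of `p`-power degree, if an involution is centralized by a point stabilizer
and all commutators with it are `p`-elements, then these commutators lie in a normal
`p`-subgroup. -/
theorem exists_normal_pGroup_of_involution {G α : Type*} [Group G] [Finite G] [MulAction G α]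
    [MulAction.IsPretransitive G α] {p m : ℕ} [Fact p.Prime] (hα : Nat.card α = p ^ m)
    {J : G} (hJ : J * J = 1) (hp : ∀ g : G, IsPGroup p (Subgroup.zpowers (g * J * g⁻¹ * J)))
    (a : α) (hst : ∀ g : G, g • a = a → g * J = J * g) :
    ∃ K : Subgroup G, K.Normal ∧ IsPGroup p K ∧ ∀ g : G, g * J * g⁻¹ * J ∈ K := by
  obtain ⟨P, hP⟩ := Sylow.exists_invariant_of_involution hJ hp
  have key : ∀ g : G, g * J * g⁻¹ * J ∈ P := by
    intro g
    obtain ⟨s, hs, hsa⟩ := P.exists_smul_eq_of_card_eq_pow hα a (g • a)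
    have h1 := hst (s⁻¹ * g) (by rw [mul_smul, ← hsa, inv_smul_smul])
    have h2 : g * J * g⁻¹ * J = s * (J * s⁻¹ * J) := by
      have : g * J * g⁻¹ = s * ((s⁻¹ * g) * J * (s⁻¹ * g)⁻¹) * s⁻¹ := by group
      rw [this, h1]; group
    rw [h2]
    exact mul_mem hs (hP _ (inv_mem hs))
  refine ⟨(P : Subgroup G).normalCore, inferInstance, P.2.to_le (Subgroup.normalCore_le _), ?_⟩
  intro g b
  have hJ' : J⁻¹ = J := inv_eq_of_mul_eq_one_left hJ
  have : b * (g * J * g⁻¹ * J) * b⁻¹ =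
      (b * g * J * (b * g)⁻¹ * J) * (b * J * b⁻¹ * J)⁻¹ := by
    have hJJ : ∀ x, J * (J * x) = x := fun x => by rw [← mul_assoc, hJ, one_mul]
    simp [mul_assoc, hJ', hJJ]
  rw [this]
  exact mul_mem (key _) (inv_mem (key _))

/-- Commutative automorphic loops, given by multiplication, identity and left division. -/
class CommAutLoop (Q : Type*) extends MulOneClass Q, CommMagma Q where
  ld : Q → Q → Q
  ld_mul : ∀ x y : Q, ld x (x * y) = y
  mul_ld : ∀ x y : Q, x * ld x y = y
  inner_mul : ∀ x y u v : Q,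
    ld (y * x) (y * (x * (u * v))) = ld (y * x) (y * (x * u)) * ld (y * x) (y * (x * v))

namespace CommAutLoop

section Basic

variable {Q : Type*} [CommAutLoop Q]

instance : Inv Q := ⟨fun x => ld x 1⟩

theorem mul_left_cancel' {x y z : Q} (h : x * y = x * z) : y = z := by
  rw [← ld_mul x y, h, ld_mul]

theorem eq_ld_iff {x y z : Q} : y = ld x z ↔ x * y = z :=
  ⟨fun h => by rw [h, mul_ld], fun h => by rw [← h, ld_mul]⟩

theorem mul_inv_self (x : Q) : x * x⁻¹ = 1 := mul_ld x 1

theorem eq_inv_of_mul {x y : Q} (h : x * y = 1) : y = x⁻¹ := eq_ld_iff.2 h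

theorem inv_invol (x : Q) : (x⁻¹)⁻¹ = x :=
  (eq_inv_of_mul (by rw [mul_comm, mul_inv_self])).symm

theorem inv_one' : (1 : Q)⁻¹ = 1 := (eq_inv_of_mul (one_mul 1)).symm

/-- The automorphic inverse property. -/
theorem inv_mul_inv (x y : Q) : (x * y)⁻¹ = x⁻¹ * y⁻¹ := by
  have ld_inv : ∀ u v : Q, (ld u v)⁻¹ = ld u⁻¹ v⁻¹ := by
    intro u y
    obtain ⟨x, rfl⟩ : ∃ x, u = y * x := ⟨ld y u, (mul_ld _ _).symm⟩
    set F : Q → Q := fun z => ld (y * x) (y * (x * z)) with hF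
    have hmul : ∀ a b, F (a * b) = F a * F b := inner_mul x y
    have h1 : F 1 = 1 := by simp only [hF, mul_one]; exact (eq_ld_iff.2 (mul_one _)).symm
    have hinv : ∀ a, F a⁻¹ = (F a)⁻¹ := fun a =>
      eq_inv_of_mul (by rw [← hmul, mul_inv_self, h1])
    have hy : F y = y := by
      simp only [hF]
      rw [eq_comm, eq_ld_iff, mul_comm (y * x) y, mul_comm x y]
    have h2 : F (ld x y⁻¹) = (y * x)⁻¹ := by
      simp only [hF, mul_ld, mul_inv_self]; rfl
    have h3 : F x⁻¹ = ld (y * x) y := by simp only [hF, mul_inv_self, mul_one]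
    have h4 : F x = (ld (y * x) y)⁻¹ := by rw [← h3, hinv, inv_invol]
    have h5 : F x * (y * x)⁻¹ = y⁻¹ := by rw [← h2, ← hmul, mul_ld, hinv, hy]
    rw [eq_ld_iff, mul_comm, ← h4, h5]
  have h := ld_inv x (x * y)
  rw [ld_mul, eq_ld_iff] at h
  exact h.symm

theorem exists_mul_self [Finite Q] (hQ : ¬ 2 ∣ Nat.card Q) (s : Q) : ∃ x : Q, x * x = s := by
  have hinv : Function.Involutive (fun x : Q => ld x s) := fun x =>
    (eq_ld_iff.2 (by rw [mul_comm, mul_ld])).symm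
  have := Fintype.ofFinite Q
  obtain ⟨x, hx⟩ := Equiv.Perm.exists_fixed_point_of_prime (p := 2) (n := 1)
    (by rwa [← Nat.card_eq_fintype_card]) (σ := hinv.toPerm)
    (by ext x; simpa [pow_two] using hinv x)
  exact ⟨x, eq_ld_iff.1 hx.symm⟩

theorem eq_one_of_inv_eq [Finite Q] (hQ : ¬ 2 ∣ Nat.card Q) {x : Q} (hx : x⁻¹ = x) : x = 1 := by
  have hinj : Function.Injective (fun x : Q => x * x) :=
    Finite.injective_iff_surjective.2 (exists_mul_self hQ)
  apply hinj
  simp only [mul_one]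
  nth_rewrite 2 [← hx]
  exact mul_inv_self x

end Basic

/-- A faithful action of a group containing the left translations `L x` and the inversion `J`,
whose stabilizer of the identity consists of automorphisms. -/
structure IsHolomorphic {Q G : Type*} [CommAutLoop Q] [Group G] [MulAction G Q]
    (L : Q → G) (J : G) : Prop where
  L_smul : ∀ x y : Q, L x • y = x * y
  J_smul : ∀ x : Q, J • x = x⁻¹
  smul_mul_of_smul_one : ∀ g : G, g • (1 : Q) = 1 → ∀ u v : Q, g • (u * v) = (g • u) * (g • v)

namespace IsHolomorphic

variable {Q G : Type*} [CommAutLoop Q] [Group G] [MulAction G Q]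
  {L : Q → G} {J : G}

theorem isPretransitive (h : IsHolomorphic L J) : MulAction.IsPretransitive G Q :=
  ⟨fun x y => ⟨L (ld x y), by rw [h.L_smul, mul_comm, mul_ld]⟩⟩

theorem L_smul_one (h : IsHolomorphic L J) (x : Q) : L x • (1 : Q) = x := by
  rw [h.L_smul, mul_one]

theorem commutator_smul_one (h : IsHolomorphic L J) (x : Q) :
    (L x * J * (L x)⁻¹ * J) • (1 : Q) = x * x := by
  have h1 : (L x)⁻¹ • (1 : Q) = x⁻¹ := by
    rw [inv_smul_eq_iff, h.L_smul, mul_inv_self]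
  simp only [mul_smul, h.L_smul, h.J_smul, inv_one', h1, inv_invol]

variable [FaithfulSMul G Q]

theorem J_mul_J (h : IsHolomorphic L J) : J * J = 1 :=
  eq_of_smul_eq_smul (α := Q) fun x => by
    rw [mul_smul, h.J_smul, h.J_smul, inv_invol, one_smul]

theorem J_inv (h : IsHolomorphic L J) : J⁻¹ = J := inv_eq_of_mul_eq_one_left h.J_mul_J

theorem J_mul_cancel (h : IsHolomorphic L J) (g : G) : J * (J * g) = g := by
  rw [← mul_assoc, h.J_mul_J, one_mul]

theorem mul_L (h : IsHolomorphic L J) {g : G} (hg : g • (1 : Q) = 1) (x : Q) :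
    g * L x = L (g • x) * g :=
  eq_of_smul_eq_smul (α := Q) fun y => by
    rw [mul_smul, mul_smul, h.L_smul, h.L_smul, h.smul_mul_of_smul_one g hg]

theorem mul_J (h : IsHolomorphic L J) {g : G} (hg : g • (1 : Q) = 1) : g * J = J * g :=
  eq_of_smul_eq_smul (α := Q) fun y => by
    rw [mul_smul, mul_smul, h.J_smul, h.J_smul]
    exact eq_inv_of_mul (by rw [← h.smul_mul_of_smul_one g hg, mul_inv_self, hg])

theorem conj_J (h : IsHolomorphic L J) (g : G) :
    g * J * g⁻¹ = L (g • (1 : Q)) * J * (L (g • (1 : Q)))⁻¹ := by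
  set a := g • (1 : Q) with ha
  have h1 : ((L a)⁻¹ * g) • (1 : Q) = 1 := by
    rw [mul_smul, ← ha, inv_smul_eq_iff, h.L_smul_one]
  have h2 := h.mul_J h1
  have : g * J * g⁻¹ = L a * (((L a)⁻¹ * g) * J * ((L a)⁻¹ * g)⁻¹) * (L a)⁻¹ := by group
  rw [this, h2]; group

theorem L_inv_eq (h : IsHolomorphic L J) (x : Q) : L x⁻¹ = J * L x * J :=
  eq_of_smul_eq_smul (α := Q) fun y => by
    simp only [mul_smul, h.L_smul, h.J_smul, inv_mul_inv, inv_invol]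

/-- A commutator with the inversion fixing a point is trivial. -/
theorem commutator_eq_one (h : IsHolomorphic L J) {g : G} {y : Q}
    (hy : (g * J * g⁻¹ * J) • y = y) : g * J * g⁻¹ * J = 1 := by
  rw [h.conj_J] at hy ⊢
  set z := g • (1 : Q)
  have h1 : L z * J * (L z)⁻¹ * J = L z * (L z⁻¹)⁻¹ := by
    rw [h.L_inv_eq]; simp [h.J_inv, mul_assoc]
  rw [h1, mul_smul] at hy
  set q := (L z⁻¹)⁻¹ • y with hq
  have h2 : z⁻¹ * q = y := by rw [← h.L_smul, hq, smul_inv_smul]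
  rw [h.L_smul] at hy
  have h3 : z = z⁻¹ := mul_left_cancel' (x := q) (by rw [mul_comm, hy, mul_comm, h2])
  rw [h1, ← h3, mul_inv_cancel]

theorem exists_pow_commutator (h : IsHolomorphic L J) (g : G) (i : ℕ) :
    ∃ b : G, (g * J * g⁻¹ * J) ^ i = b * J * b⁻¹ * J := by
  set w := g * J * g⁻¹ * J with hw
  have hwJ : J * w⁻¹ * J = w := by simp [hw, mul_assoc, h.J_inv, h.J_mul_cancel]
  induction i using Nat.twoStepInduction with
  | zero => exact ⟨1, by simp [h.J_mul_J]⟩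
  | one => exact ⟨g, by rw [pow_one]⟩
  | more i ih _ =>
    obtain ⟨b, hb⟩ := ih
    refine ⟨w * b, ?_⟩
    have h1 : w * b * J * (w * b)⁻¹ * J = w * (b * J * b⁻¹ * J) * (J * w⁻¹ * J) := by
      simp [mul_assoc, h.J_mul_cancel]
    rw [h1, hwJ, ← hb, pow_succ, pow_succ', mul_assoc, mul_assoc]

theorem isPGroup_commutator [Finite G] [Finite Q] {p m : ℕ} [Fact p.Prime]
    (hQ : Nat.card Q = p ^ m) (h : IsHolomorphic L J) (g : G) :
    IsPGroup p (Subgroup.zpowers (g * J * g⁻¹ * J)) := by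
  have hp : p.Prime := Fact.out
  set w := g * J * g⁻¹ * J with hw
  have horder : orderOf w = p ^ (orderOf w).primeFactorsList.length := by
    refine Nat.eq_prime_pow_of_unique_prime_dvd (orderOf_pos w).ne' fun {r} hr hrw => ?_
    by_contra hrp
    have : Fact r.Prime := ⟨hr⟩
    set v := w ^ (orderOf w / r) with hv
    have hvr : orderOf v = r := orderOf_pow_orderOf_div (orderOf_pos w).ne' hrw
    have hv1 : v ≠ 1 := fun h1 => hr.one_lt.ne' (by rw [← hvr, h1, orderOf_one])
    have hpg : IsPGroup r (Subgroup.zpowers v) :=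
      IsPGroup.of_card (n := 1) (by rw [Nat.card_zpowers, hvr, pow_one])
    obtain ⟨y, hy⟩ := hpg.nonempty_fixed_point_of_prime_not_dvd_card Q (by
      rw [hQ]
      exact fun hd => hrp ((Nat.prime_dvd_prime_iff_eq hr hp).1 (hr.dvd_of_dvd_pow hd)))
    have hvy : v • y = y := hy ⟨v, Subgroup.mem_zpowers v⟩
    obtain ⟨b, hb⟩ := h.exists_pow_commutator g (orderOf w / r)
    rw [← hw, ← hv] at hb
    rw [hb] at hvy
    exact hv1 (hb.trans (h.commutator_eq_one hvy))
  exact IsPGroup.of_card (by rw [Nat.card_zpowers, horder])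

theorem centralizer_inf_fixed (h : IsHolomorphic L J) {K : Subgroup G}
    (hK : ∀ x, L x * J * (L x)⁻¹ * J ∈ K) (hsq : ∀ y : Q, ∃ s, s * s = y) {z : G}
    (hz : z ∈ Subgroup.centralizer (K : Set G)) (hz1 : z • (1 : Q) = 1) : z = 1 :=
  eq_of_smul_eq_smul (α := Q) fun y => by
    obtain ⟨s, rfl⟩ := hsq y
    rw [← h.commutator_smul_one, smul_smul,
      ← Subgroup.mem_centralizer_iff.1 hz _ (hK s), ← smul_smul, hz1, one_smul]

theorem J_mul_mul_J (h : IsHolomorphic L J) {K : Subgroup G} [K.Normal]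
    (hK : ∀ x, L x * J * (L x)⁻¹ * J ∈ K) (hsq : ∀ y : Q, ∃ s, s * s = y)
    (hinv : ∀ y : Q, y⁻¹ = y → y = 1) {z : G}
    (hz : z ∈ K ⊓ Subgroup.centralizer (K : Set G)) : J * z * J = z⁻¹ := by
  have hc : J * z * J ∈ K ⊓ Subgroup.centralizer (K : Set G) := by
    have := (inferInstance : (K ⊓ Subgroup.centralizer (K : Set G)).Normal).conj_mem z hz J
    rwa [h.J_inv] at this
  have hcomm : z * (J * z * J) = J * z * J * z := Subgroup.mem_centralizer_iff.1 hc.2 z hz.1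
  set s := z * (J * z * J) with hs
  have hsJ : J * s = s * J := by
    nth_rewrite 2 [hcomm]
    simp [hs, mul_assoc]
  have hs1 : s • (1 : Q) = 1 := by
    apply hinv
    rw [← h.J_smul, smul_smul, hsJ, ← smul_smul, h.J_smul, inv_one']
  have := h.centralizer_inf_fixed hK hsq (mul_mem hz hc).2 hs1
  exact (inv_eq_of_mul_eq_one_right this).symm

/-- Central elements of a normal `p`-subgroup containing the commutators `[L x, J]` commute with
all left translations. -/
theorem mul_L_of_mem_centralizer (h : IsHolomorphic L J) {K : Subgroup G} [K.Normal]
    {p : ℕ} [Fact p.Prime] (hp2 : p ≠ 2) (hKp : IsPGroup p K)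
    (hK : ∀ x, L x * J * (L x)⁻¹ * J ∈ K) (hsq : ∀ y : Q, ∃ s, s * s = y)
    (hinv : ∀ y : Q, y⁻¹ = y → y = 1) {z : G}
    (hz : z ∈ K ⊓ Subgroup.centralizer (K : Set G)) (x : Q) : L x * z = z * L x := by
  set C := K ⊓ Subgroup.centralizer (K : Set G) with hC
  have hCn : C.Normal := inferInstance
  have hcomm : ∀ u ∈ K, ∀ v ∈ C, u * v = v * u := fun u hu v hv =>
    Subgroup.mem_centralizer_iff.1 hv.2 u hu
  have hJ : ∀ u ∈ C, J * u * J = u⁻¹ := fun u hu => h.J_mul_mul_J hK hsq hinv hu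
  set a := z • (1 : Q) with ha
  set k := z⁻¹ * L a with hk
  have hk1 : k • (1 : Q) = 1 := by rw [hk, mul_smul, h.L_smul_one, ha, inv_smul_smul]
  set ζ : Q → G := fun x => L x * z * (L x)⁻¹ * z⁻¹ with hζ
  have hζC : ∀ x, ζ x ∈ C := fun x => mul_mem (hCn.conj_mem z hz _) (inv_mem hz)
  have hkx : ∀ x, k • x = ζ x • x := by
    intro x
    have h1 : ζ x = z⁻¹ * L x * z * (L x)⁻¹ := by
      have := hcomm z⁻¹ (inv_mem hz.1) _ (hCn.conj_mem z hz (L x))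
      rw [hζ]; simp only [mul_assoc] at this ⊢; exact this.symm
    have h2 : (L x)⁻¹ • x = 1 := by rw [inv_smul_eq_iff, h.L_smul_one]
    rw [h1, hk]
    simp only [mul_smul, h2, h.L_smul, ← ha]
    rw [mul_comm]
  set P : Q → G := fun x => L x * J * (L x)⁻¹ * J with hP
  have hPk : ∀ x, k * P x * k⁻¹ = ζ x ^ 2 * P x := by
    intro x
    have h1 := h.conj_J (ζ x * L x)
    rw [mul_smul, h.L_smul_one, ← hkx] at h1
    have h2 : L (k • x) = k * L x * k⁻¹ := by rw [h.mul_L hk1, mul_inv_cancel_right]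
    have h3 : k⁻¹ * J * k = J := by rw [mul_assoc, ← h.mul_J hk1, inv_mul_cancel_left]
    have h4 : k * J * k⁻¹ = J := by rw [h.mul_J hk1, mul_inv_cancel_right]
    have h5 : L (k • x) * J * (L (k • x))⁻¹ = k * (P x * J) * k⁻¹ := by
      rw [h2]
      have : k * L x * k⁻¹ * J * (k * L x * k⁻¹)⁻¹
          = k * L x * (k⁻¹ * J * k) * (L x)⁻¹ * k⁻¹ := by group
      rw [this, h3]
      simp [hP, mul_assoc, h.J_mul_J]
    have h6 : k * P x * k⁻¹ = k * (P x * J) * k⁻¹ * (k * J * k⁻¹) := by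
      simp [mul_assoc, h.J_mul_cancel]
    have h7 : J * (ζ x)⁻¹ * J = ζ x := by rw [hJ _ (inv_mem (hζC x)), inv_inv]
    have h8 : ζ x * L x * J * (ζ x * L x)⁻¹ * J = ζ x * P x * (J * (ζ x)⁻¹ * J) := by
      simp [hP, mul_assoc, h.J_mul_cancel]
    rw [h6, ← h5, ← h1, h4, h8, h7, mul_assoc, hcomm _ (hK x) _ (hζC x), ← mul_assoc, pow_two]
  have hPi : P x⁻¹ = (P x)⁻¹ := by
    simp [hP, h.L_inv_eq, mul_assoc, h.J_mul_cancel, h.J_mul_J, h.J_inv]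
  have hζi : ζ x⁻¹ = ζ x := by
    have h1 : J * (L x * z⁻¹ * (L x)⁻¹) * J = L x * z * (L x)⁻¹ := by
      rw [hJ _ (hCn.conj_mem _ (inv_mem hz) _)]; group
    have h2 : ζ x⁻¹ = J * L x * (J * z * J) * (L x)⁻¹ * J * z⁻¹ := by
      simp [hζ, h.L_inv_eq, mul_assoc, h.J_inv]
    rw [h2, hJ z hz, hζ]
    simp only [← h1, mul_assoc]
  have h4 : ζ x ^ 4 = 1 := by
    have h1 := hPk x⁻¹
    rw [hPi, hζi] at h1
    have h2 : (1 : G) = (k * P x * k⁻¹) * (k * (P x)⁻¹ * k⁻¹) := by group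
    rw [hPk x, h1, mul_assoc, ← mul_assoc (P x),
      hcomm (P x) (hK x) _ (pow_mem (hζC x) 2)] at h2
    rw [h2]; group
  have hζ1 : ζ x = 1 := by
    obtain ⟨n, hn⟩ := hKp ⟨ζ x, (hζC x).1⟩
    have hn' : ζ x ^ p ^ n = 1 := congrArg Subtype.val hn
    have hcop : (p ^ n).Coprime 4 := by
      have : (p ^ n).Coprime (2 ^ 2) := Nat.Coprime.pow _ _
        ((Nat.coprime_primes Fact.out Nat.prime_two).2 hp2)
      exact this
    rw [← orderOf_eq_one_iff, ← Nat.dvd_one, ← hcop.gcd_eq_one]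
    exact Nat.dvd_gcd (orderOf_dvd_of_pow_eq_one hn') (orderOf_dvd_of_pow_eq_one h4)
  have : L x * z * (L x)⁻¹ = z := mul_inv_eq_one.1 hζ1
  exact mul_inv_eq_iff_eq_mul.1 this

theorem exists_ne_one_assoc [Finite G] [Finite Q] [Nontrivial Q] {p m : ℕ} [Fact p.Prime]
    (hp2 : p ≠ 2) (hQ : Nat.card Q = p ^ m) (h : IsHolomorphic L J) :
    ∃ a : Q, a ≠ 1 ∧ ∀ x y : Q, y * (x * a) = (y * x) * a := by
  have hodd : ¬ 2 ∣ Nat.card Q := by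
    rw [hQ]
    exact fun hd => hp2 ((Nat.prime_dvd_prime_iff_eq Nat.prime_two Fact.out).1
      (Nat.prime_two.dvd_of_dvd_pow hd)).symm
  have hsq := exists_mul_self hodd
  have hinv : ∀ y : Q, y⁻¹ = y → y = 1 := fun y => eq_one_of_inv_eq hodd
  have := h.isPretransitive
  obtain ⟨K, hKn, hKp, hK⟩ := exists_normal_pGroup_of_involution hQ h.J_mul_J
    (h.isPGroup_commutator hQ) (1 : Q) (fun g => h.mul_J)
  have hK' : ∀ x, L x * J * (L x)⁻¹ * J ∈ K := fun x => hK (L x)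
  have : Nontrivial K := by
    obtain ⟨x, hx⟩ := exists_ne (1 : Q)
    obtain ⟨s, rfl⟩ := hsq x
    refine (Subgroup.nontrivial_iff_exists_ne_one K).2 ⟨_, hK' s, fun h1 => hx ?_⟩
    rw [← h.commutator_smul_one, h1, one_smul]
  have := hKp.center_nontrivial
  obtain ⟨⟨⟨z, hzK⟩, hzc⟩, hz1⟩ := exists_ne (1 : Subgroup.center K)
  have hz : z ∈ K ⊓ Subgroup.centralizer (K : Set G) :=
    ⟨hzK, Subgroup.mem_centralizer_iff.2 fun g hg =>
      congrArg Subtype.val (Subgroup.mem_center_iff.1 hzc ⟨g, hg⟩)⟩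
  have hL := h.mul_L_of_mem_centralizer hp2 hKp hK' hsq hinv hz
  refine ⟨z • (1 : Q), fun h1 => hz1 ?_, fun x y => ?_⟩
  · have := h.centralizer_inf_fixed hK' hsq hz.2 h1
    subst this; rfl
  · have hmul : ∀ u v : Q, u * z • v = z • (u * v) := fun u v => by
      rw [← h.L_smul, smul_smul, hL, ← smul_smul, h.L_smul]
    simp only [hmul, mul_one]

end IsHolomorphic

section Holomorph

variable {Q : Type*} [CommAutLoop Q]

/-- The left translation by `x`, as a permutation. -/
def leftTranslation (x : Q) : Equiv.Perm Q where
  toFun := (x * ·)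
  invFun := ld x
  left_inv := ld_mul x
  right_inv := mul_ld x

variable (Q) in
/-- The automorphism group of a loop, as a group of permutations. -/
def autSubgroup : Subgroup (Equiv.Perm Q) where
  carrier := {α | ∀ u v, α (u * v) = α u * α v}
  one_mem' := fun _ _ => rfl
  mul_mem' := fun {α β} hα hβ u v => by
    rw [Equiv.Perm.mul_apply, hβ, hα]; rfl
  inv_mem' := fun {α} hα u v => by
    rw [Equiv.Perm.inv_eq_iff_eq, hα, ← Equiv.Perm.mul_apply, ← Equiv.Perm.mul_apply,
      mul_inv_cancel, Equiv.Perm.one_apply, Equiv.Perm.one_apply]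

theorem map_one_of_mem {α : Equiv.Perm Q} (hα : α ∈ autSubgroup Q) : α 1 = 1 := by
  have : α 1 * α 1 = α 1 * 1 := by rw [← hα, mul_one, mul_one]
  exact mul_left_cancel' this

theorem mul_leftTranslation {α : Equiv.Perm Q} (hα : α ∈ autSubgroup Q) (x : Q) :
    α * leftTranslation x = leftTranslation (α x) * α :=
  Equiv.ext fun y => hα x y

theorem inner_mem_autSubgroup (x y : Q) :
    (leftTranslation (y * x))⁻¹ * leftTranslation y * leftTranslation x ∈ autSubgroup Q :=
  inner_mul x y

variable (Q) in
/-- The holomorph of a commutative automorphic loop, as a group of permutations. -/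
def holomorph : Subgroup (Equiv.Perm Q) where
  carrier := {g | ∃ x, ∃ α ∈ autSubgroup Q, g = leftTranslation x * α}
  one_mem' := ⟨1, 1, one_mem _, Equiv.ext fun x => (one_mul (x : Q)).symm.trans rfl⟩
  mul_mem' := by
    rintro _ _ ⟨x, α, hα, rfl⟩ ⟨y, β, hβ, rfl⟩
    refine ⟨x * α y, _, mul_mem (mul_mem (inner_mem_autSubgroup (α y) x) hα) hβ, ?_⟩
    have h1 : leftTranslation x * α * (leftTranslation y * β)
        = leftTranslation x * (α * leftTranslation y) * β := by group
    rw [h1, mul_leftTranslation hα]; group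
  inv_mem' := by
    rintro _ ⟨x, α, hα, rfl⟩
    have h1 : leftTranslation (x⁻¹ * x) = 1 := Equiv.ext fun y => by
      rw [mul_comm x⁻¹, mul_inv_self]; exact one_mul y
    have h2 : leftTranslation x⁻¹ * leftTranslation x ∈ autSubgroup Q := by
      simpa [h1] using inner_mem_autSubgroup x x⁻¹
    have hγ := mul_mem (inv_mem hα) (inv_mem h2)
    refine ⟨(α⁻¹ * (leftTranslation x⁻¹ * leftTranslation x)⁻¹) x⁻¹, _, hγ, ?_⟩
    rw [← mul_leftTranslation hγ x⁻¹]; group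

theorem isHolomorphic_holomorph : ∃ (L : Q → holomorph Q) (J : holomorph Q),
    IsHolomorphic L J := by
  have haut : ∀ α ∈ autSubgroup Q, α ∈ holomorph Q := fun α hα =>
    ⟨1, α, hα, Equiv.ext fun x => (one_mul _).symm⟩
  refine ⟨fun x => ⟨leftTranslation x, x, 1, one_mem _, (mul_one _).symm⟩,
    ⟨Function.Involutive.toPerm (fun x : Q => x⁻¹) inv_invol, haut _ inv_mul_inv⟩,
    fun _ _ => rfl, fun _ => rfl, ?_⟩
  rintro ⟨_, x, α, hα, rfl⟩ h1
  have hx : x = 1 := by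
    have : x * α 1 = 1 := h1
    rwa [map_one_of_mem hα, mul_one] at this
  subst hx
  intro u v
  change 1 * α (u * v) = 1 * α u * (1 * α v)
  rw [one_mul, one_mul, one_mul, hα]

theorem exists_ne_one_assoc [Finite Q] [Nontrivial Q] {p m : ℕ} [Fact p.Prime]
    (hp2 : p ≠ 2) (hQ : Nat.card Q = p ^ m) :
    ∃ a : Q, a ≠ 1 ∧ ∀ x y : Q, y * (x * a) = (y * x) * a := by
  obtain ⟨L, J, h⟩ := isHolomorphic_holomorph (Q := Q)
  exact h.exists_ne_one_assoc hp2 hQ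

end Holomorph

section Nilpotency

variable (Q : Type*) [CommAutLoop Q]

/-- The terms of the upper central series. -/
def upperCentral : ℕ → Set Q
  | 0 => {1}
  | k + 1 => {a | ∀ x y : Q, ∃ t ∈ upperCentral k, ld (y * x) (y * (x * a)) = a * t}

/-- The center of a commutative automorphic loop. -/
def center : Set Q := {c | ∀ x y : Q, y * (x * c) = (y * x) * c}

variable {Q}

theorem mul_mul_mul_of_mem_center {c d : Q} (hc : c ∈ center Q) (hd : d ∈ center Q) (x y : Q) :
    (x * c) * (y * d) = (x * y) * (c * d) := by
  rw [hd, mul_comm (x * c) y, hc, mul_comm y x, hd]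

theorem one_mem_center : (1 : Q) ∈ center Q := fun x y => by rw [mul_one, mul_one]

theorem mul_mem_center {c d : Q} (hc : c ∈ center Q) (hd : d ∈ center Q) : c * d ∈ center Q :=
  fun x y => by rw [hd, hd, hc, hd]

theorem inv_mem_center {c : Q} (hc : c ∈ center Q) : c⁻¹ ∈ center Q := fun x y => by
  have h : ∀ w : Q, (w * c⁻¹) * c = w := fun w => by
    rw [← hc, mul_comm c⁻¹, mul_inv_self, mul_one]
  have h1 : c * (y * (x * c⁻¹)) = c * ((y * x) * c⁻¹) := by
    rw [mul_comm c, mul_comm c, ← hc, h, h]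
  exact mul_left_cancel' h1

variable (Q) in
/-- Congruence modulo the center. -/
def centerSetoid : Setoid Q where
  r x y := ∃ c ∈ center Q, y = x * c
  iseqv :=
    { refl := fun x => ⟨1, one_mem_center, (mul_one x).symm⟩
      symm := by
        rintro x _ ⟨c, hc, rfl⟩
        exact ⟨c⁻¹, inv_mem_center hc, by rw [← inv_mem_center hc, mul_inv_self, mul_one]⟩
      trans := by
        rintro x _ _ ⟨c, hc, rfl⟩ ⟨d, hd, rfl⟩
        exact ⟨c * d, mul_mem_center hc hd, (hd c x).symm⟩ }

instance : CommAutLoop (Quotient (centerSetoid Q)) where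
  mul := Quotient.map₂ (· * ·) (by
    rintro x _ ⟨c, hc, rfl⟩ y _ ⟨d, hd, rfl⟩
    exact ⟨c * d, mul_mem_center hc hd, mul_mul_mul_of_mem_center hc hd x y⟩)
  one := Quotient.mk _ 1
  ld := Quotient.map₂ ld (by
    rintro x _ ⟨c, hc, rfl⟩ y _ ⟨d, hd, rfl⟩
    have hc' := inv_mem_center hc
    refine ⟨c⁻¹ * d, mul_mem_center hc' hd, ?_⟩
    rw [eq_comm, eq_ld_iff, mul_mul_mul_of_mem_center hc (mul_mem_center hc' hd), mul_ld, hd,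
      mul_inv_self, one_mul])
  one_mul := by rintro ⟨x⟩; exact congrArg (Quotient.mk _) (one_mul x)
  mul_one := by rintro ⟨x⟩; exact congrArg (Quotient.mk _) (mul_one x)
  mul_comm := by rintro ⟨x⟩ ⟨y⟩; exact congrArg (Quotient.mk _) (mul_comm x y)
  ld_mul := by rintro ⟨x⟩ ⟨y⟩; exact congrArg (Quotient.mk _) (ld_mul x y)
  mul_ld := by rintro ⟨x⟩ ⟨y⟩; exact congrArg (Quotient.mk _) (mul_ld x y)
  inner_mul := by
    rintro ⟨x⟩ ⟨y⟩ ⟨u⟩ ⟨v⟩; exact congrArg (Quotient.mk _) (inner_mul x y u v)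

theorem mem_upperCentral_succ_of_mk {k : ℕ} {a : Q}
    (ha : Quotient.mk (centerSetoid Q) a ∈ upperCentral (Quotient (centerSetoid Q)) k) :
    a ∈ upperCentral Q (k + 1) := by
  induction k generalizing a with
  | zero =>
    obtain ⟨c, hc, h1⟩ := Quotient.exact (Eq.symm (ha : Quotient.mk (centerSetoid Q) a = 1))
    rw [one_mul] at h1
    subst h1
    exact fun x y => ⟨1, rfl, by rw [hc, ld_mul, mul_one]⟩
  | succ k ih =>
    intro x y
    obtain ⟨t, ht, h1⟩ := ha (Quotient.mk _ x) (Quotient.mk _ y)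
    refine ⟨ld a (ld (y * x) (y * (x * a))), ih ?_, (mul_ld _ _).symm⟩
    rw [eq_ld_iff.2 h1.symm] at ht
    exact ht

theorem card_quotient_mul_card_center :
    Nat.card (Quotient (centerSetoid Q)) * Nat.card (center Q) = Nat.card Q := by
  rw [← Nat.card_prod]
  refine Nat.card_eq_of_bijective (fun z => z.1.out * (z.2 : Q)) ⟨?_, ?_⟩
  · rintro ⟨q, c, hc⟩ ⟨r, d, hd⟩ h
    have h' : q.out * c = r.out * d := h
    have key : ∀ (q : Quotient (centerSetoid Q)), ∀ c ∈ center Q,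
        Quotient.mk (centerSetoid Q) (q.out * c) = q := fun q c hc =>
      (Quotient.sound (s := centerSetoid Q) ⟨c, hc, rfl⟩).symm.trans q.out_eq
    have h1 : q = r := by rw [← key q c hc, h', key r d hd]
    subst h1
    have := mul_left_cancel' h'
    subst this; rfl
  · intro x
    obtain ⟨c, hc, h⟩ := Quotient.exact (Quotient.out_eq (Quotient.mk (centerSetoid Q) x))
    exact ⟨(Quotient.mk _ x, ⟨c, hc⟩), h.symm⟩

theorem exists_upperCentral_eq_univ {p : ℕ} [Fact p.Prime] (hp2 : p ≠ 2) {m : ℕ} {Q : Type*}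
    [CommAutLoop Q] (hQ : Nat.card Q = p ^ m) : ∃ n, upperCentral Q n = Set.univ := by
  induction m using Nat.strong_induction_on generalizing Q with
  | _ m ih =>
    have hp : p.Prime := Fact.out
    have : Finite Q := Nat.finite_of_card_ne_zero (by rw [hQ]; exact (pow_pos hp.pos m).ne')
    rcases subsingleton_or_nontrivial Q with hs | hs
    · exact ⟨0, Set.eq_univ_of_forall fun a => Subsingleton.elim a 1⟩
    obtain ⟨a, ha1, ha⟩ := exists_ne_one_assoc hp2 hQ
    have hcard := card_quotient_mul_card_center (Q := Q)
    have hC : 1 < Nat.card (center Q) := Finite.one_lt_card_iff_nontrivial.2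
      ⟨⟨⟨a, ha⟩, ⟨1, one_mem_center⟩, fun h => ha1 (congrArg Subtype.val h)⟩⟩
    obtain ⟨j, hj, hj'⟩ := (Nat.dvd_prime_pow hp).1 (hQ ▸ Dvd.intro _ hcard)
    have hjm : j < m := by
      refine lt_of_le_of_ne hj fun h => ?_
      rw [hj', hQ, h] at hcard
      exact hC.ne' (mul_eq_left₀ (pow_pos hp.pos m).ne' |>.1 hcard)
    obtain ⟨n, hn⟩ := ih j hjm hj'
    refine ⟨n + 1, Set.eq_univ_of_forall fun b => mem_upperCentral_succ_of_mk ?_⟩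
    rw [hn]; trivial

end Nilpotency

end CommAutLoop

/-- **Theorem 1.1 (main theorem).** Every finite commutative automorphic `p`-loop
(`p` an odd prime) is centrally nilpotent; in particular its center is nontrivial
when the loop is nontrivial. The loop `(Q, mul, ld, one)` is given by its
multiplication, left division and identity; the inner mappings are
`L_{x,y} : z ↦ (y·x) \ (y·(x·z))`, and `Z` is the upper central series. -/
theorem commutative_automorphic_p_loop_is_centrally_nilpotent
    (p : ℕ) (hp : p.Prime) (hodd : p ≠ 2)
    (Q : Type) [Fintype Q] (mul ld : Q → Q → Q) (one : Q)
    (hld1 : ∀ x y : Q, ld x (mul x y) = y)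
    (hld2 : ∀ x y : Q, mul x (ld x y) = y)
    (hone1 : ∀ x : Q, mul one x = x)
    (hone2 : ∀ x : Q, mul x one = x)
    (hcomm : ∀ x y : Q, mul x y = mul y x)
    (hauto : ∀ x y u v : Q,
      ld (mul y x) (mul y (mul x (mul u v))) =
        mul (ld (mul y x) (mul y (mul x u))) (ld (mul y x) (mul y (mul x v))))
    (hcard : ∃ m : ℕ, Fintype.card Q = p ^ m)
    (Z : ℕ → Set Q)
    (hZ0 : Z 0 = {one})
    (hZsucc : ∀ k : ℕ, Z (k + 1) =
      {a : Q | ∀ x y : Q, ∃ t ∈ Z k, ld (mul y x) (mul y (mul x a)) = mul a t}) :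
    (∃ n : ℕ, Z n = Set.univ) ∧
    (1 < Fintype.card Q →
      ∃ a : Q, a ≠ one ∧ ∀ x y : Q, ld (mul y x) (mul y (mul x a)) = a) := by
  have : Fact p.Prime := ⟨hp⟩
  let _ : CommAutLoop Q :=
    { mul := mul, one := one, one_mul := hone1, mul_one := hone2, mul_comm := hcomm, ld := ld,
      ld_mul := hld1, mul_ld := hld2, inner_mul := hauto }
  obtain ⟨m, hm⟩ := hcard
  rw [← Nat.card_eq_fintype_card] at hm
  have hZ : ∀ k, Z k = CommAutLoop.upperCentral Q k := by
    intro k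
    induction k with
    | zero => exact hZ0
    | succ k ih => rw [hZsucc, ih]; rfl
  refine ⟨?_, fun h => ?_⟩
  · obtain ⟨n, hn⟩ := CommAutLoop.exists_upperCentral_eq_univ hodd hm
    exact ⟨n, (hZ n).trans hn⟩
  · have : Nontrivial Q := Fintype.one_lt_card_iff_nontrivial.1 h
    obtain ⟨a, ha1, ha⟩ := CommAutLoop.exists_ne_one_assoc hodd hm
    refine ⟨a, ha1, fun x y => ?_⟩
    have h1 : mul y (mul x a) = mul (mul y x) a := ha x y
    rw [h1, hld1]
end

section
/- In a commutative automorphic loop (Q,·,\,1), for all x,y ∈ Q one has x·P_y(x) = (x·y)·(x·y); explicitly, x·( y⁻¹ \ (y·x) ) = (x·y)·(x·y). -/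
/-- **Lemma 2.3, equation (2.7).** In a commutative automorphic loop,
`x · P_y(x) = (x·y)²`, where `x⁻¹ := x \ 1` and `P_y(x) := y⁻¹ \ (y·x)`. -/
theorem comm_automorphic_x_mul_P_y_x_eq_sq
    (Q : Type) (mul ld : Q → Q → Q) (one : Q)
    (hld1 : ∀ x y : Q, ld x (mul x y) = y)
    (hld2 : ∀ x y : Q, mul x (ld x y) = y)
    (hone1 : ∀ x : Q, mul one x = x)
    (hone2 : ∀ x : Q, mul x one = x)
    (hcomm : ∀ x y : Q, mul x y = mul y x)
    (hauto : ∀ x y u v : Q,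
      ld (mul y x) (mul y (mul x (mul u v))) =
        mul (ld (mul y x) (mul y (mul x u))) (ld (mul y x) (mul y (mul x v)))) :
    ∀ x y : Q, mul x (ld (ld y one) (mul y x)) = mul (mul x y) (mul x y) := by
  intro x y
  have cancel : ∀ a b c : Q, mul a b = mul a c → b = c := fun a b c h => by
    rw [← hld1 a b, h, hld1]
  have mul_inv (a : Q) : mul a (ld a one) = one := hld2 a one
  -- The inner mapping `L_{u,a}` fixes `a`, hence `a⁻¹`; so translations by `a` and `a⁻¹` commute.
  have inv_comm (a u : Q) : mul a (mul (ld a one) u) = mul (ld a one) (mul a u) := by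
    have h := hauto u a a (ld a one)
    rw [mul_inv, hone2, hcomm u a, hcomm u (ld a one)] at h
    rw [hcomm a (mul a u), hld1] at h
    have h1 : ld (mul a u) (mul a u) = one := by
      have := hld1 (mul a u) one
      rwa [hone2] at this
    rw [h1] at h
    have h2 := cancel _ _ _ ((mul_inv a).trans h)
    have h3 := hld2 (mul a u) (mul a (mul (ld a one) u))
    rw [← h2] at h3
    rw [← h3, hcomm]
  -- Apply the automorphism `L_{y,x}`, which fixes `x`, to `y⁻¹ · (y⁻¹ \ x) = x`.
  have h := hauto y x (ld y one) (ld (ld y one) x)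
  rw [hld2, mul_inv, hone2, hcomm y x, hcomm x (mul x y), hld1] at h
  have h1 : mul (ld (mul x y) x) (mul x y) = x := by rw [hcomm, hld2]
  have h2 := cancel _ _ _ (h1.trans h)
  have h3 := hld2 (mul x y) (mul x (mul y (ld (ld y one) x)))
  rw [← h2] at h3
  have h4 : ld (ld y one) (mul y x) = mul y (ld (ld y one) x) := by
    apply cancel (ld y one)
    rw [hld2, ← inv_comm, hld2]
  rw [h4, h3]
end

section
/- Let (Q,·,\,1) be a uniquely 2-divisible commutative automorphic loop and let a ∈ Q satisfy P_a(P_x(y)) = P_x(P_a(y)) for all x,y ∈ Q (i.e., a lies in the center of the associated Bruck loop). Then for all x ∈ Q, L_{a\x, a}(x) = L_{a\x⁻¹, a}(x); explicitly, x \ ( a·((a\x)·x) ) = x⁻¹ \ ( a·((a\x⁻¹)·x) ). -/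
/-- A commutative automorphic loop. -/
structure CommAutoLoop (Q : Type*) where
  mul : Q → Q → Q
  ld : Q → Q → Q
  one : Q
  ld_mul : ∀ x y, ld x (mul x y) = y
  mul_ld : ∀ x y, mul x (ld x y) = y
  one_mul : ∀ x, mul one x = x
  mul_comm : ∀ x y, mul x y = mul y x
  inner_mul : ∀ x y u v,
    ld (mul y x) (mul y (mul x (mul u v))) =
      mul (ld (mul y x) (mul y (mul x u))) (ld (mul y x) (mul y (mul x v)))

namespace CommAutoLoop

variable {Q : Type*} (S : CommAutoLoop Q)

/-- Left translation, as a permutation. -/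
def L (x : Q) : Equiv.Perm Q where
  toFun := S.mul x
  invFun := S.ld x
  left_inv := S.ld_mul x
  right_inv := S.mul_ld x

/-- The inverse of an element. -/
def inv (x : Q) : Q := S.ld x S.one

/-- The permutation `P_x` defining the associated Bruck loop. -/
def P (x : Q) : Equiv.Perm Q := (S.L (S.inv x))⁻¹ * S.L x

/-- The inner mapping `L_{x,y}`. -/
def inner (x y : Q) : Equiv.Perm Q := (S.L (S.mul y x))⁻¹ * S.L y * S.L x

lemma L_apply (x y : Q) : S.L x y = S.mul x y := rfl

lemma L_inv_apply (x y : Q) : (S.L x)⁻¹ y = S.ld x y := rfl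

lemma inner_apply (x y z : Q) : S.inner x y z = S.ld (S.mul y x) (S.mul y (S.mul x z)) := rfl

lemma mul_one (x : Q) : S.mul x S.one = x := by rw [S.mul_comm, S.one_mul]

lemma mul_left_cancel {x y z : Q} (h : S.mul x y = S.mul x z) : y = z := (S.L x).injective h

lemma mul_inv (x : Q) : S.mul x (S.inv x) = S.one := S.mul_ld _ _

lemma eq_inv_of_mul {x y : Q} (h : S.mul x y = S.one) : y = S.inv x :=
  S.mul_left_cancel (h.trans (S.mul_inv x).symm)

lemma inv_inv (x : Q) : S.inv (S.inv x) = x :=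
  (S.eq_inv_of_mul (by rw [S.mul_comm, S.mul_inv])).symm

lemma L_one : S.L S.one = 1 := Equiv.ext S.one_mul

lemma inv_one : S.inv S.one = S.one := (S.eq_inv_of_mul (S.one_mul _)).symm

lemma map_one {f : Equiv.Perm Q} (hf : ∀ u v, f (S.mul u v) = S.mul (f u) (f v)) :
    f S.one = S.one := by
  apply S.mul_left_cancel (x := f S.one)
  rw [← hf, S.mul_one, S.mul_one]

lemma map_inv {f : Equiv.Perm Q} (hf : ∀ u v, f (S.mul u v) = S.mul (f u) (f v)) (x : Q) :
    f (S.inv x) = S.inv (f x) :=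
  S.eq_inv_of_mul (by rw [← hf, S.mul_inv, S.map_one hf])

lemma mul_L {f : Equiv.Perm Q} (hf : ∀ u v, f (S.mul u v) = S.mul (f u) (f v)) (x : Q) :
    f * S.L x = S.L (f x) * f :=
  Equiv.ext fun y => hf x y

lemma map_inner (x y u v : Q) :
    S.inner x y (S.mul u v) = S.mul (S.inner x y u) (S.inner x y v) := S.inner_mul x y u v

lemma inner_fix (x y : Q) : S.inner x y y = y := by
  rw [inner_apply, S.mul_comm x y, S.mul_comm y (S.mul y x), S.ld_mul]

lemma inner_L (x y : Q) : Commute (S.inner x y) (S.L y) := by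
  have := S.mul_L (S.map_inner x y) y
  rwa [inner_fix] at this

lemma L_commute_inv (x : Q) : Commute (S.L x) (S.L (S.inv x)) := by
  have h := (S.inner_L (S.inv x) x).eq
  simp only [inner, S.mul_inv, S.L_one, _root_.inv_one, _root_.one_mul] at h
  rw [mul_assoc] at h
  exact (_root_.mul_left_cancel h).symm

/-- The automorphic inverse property. -/
lemma inv_mul (u v : Q) : S.inv (S.mul u v) = S.mul (S.inv u) (S.inv v) := by
  obtain ⟨x, hx⟩ : ∃ x, x = S.mul u v := ⟨_, rfl⟩
  obtain ⟨y, hy⟩ : ∃ y, y = S.ld x u := ⟨_, rfl⟩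
  have hxy : S.mul x y = u := by rw [hy, S.mul_ld]
  have hyv : S.inner y x (S.inv y) = v := by
    rw [inner_apply, S.mul_inv, hxy, S.mul_one, hx, S.ld_mul]
  have hyv' : S.inner y x y = S.inv v := by
    rw [← hyv, S.map_inv (S.map_inner y x), S.inv_inv]
  have h := S.mul_L (S.map_inner y x) y
  rw [hyv'] at h
  have h2 : S.inner y x = S.L (S.inv v) * ((S.L u)⁻¹ * S.L x) := by
    apply mul_right_cancel (b := S.L y)
    rw [h, mul_assoc (S.L (S.inv v))]
    simp only [inner, hxy]
  have h3 : S.inner y x (S.inv x) = S.inv x := by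
    rw [S.map_inv (S.map_inner y x), inner_fix]
  rw [h2] at h3
  simp only [Equiv.Perm.mul_apply, L_apply, L_inv_apply, S.mul_inv] at h3
  rw [← hx, ← h3, S.mul_comm]
  rfl

lemma inner_inv (x y : Q) : S.inner (S.inv x) (S.inv y) = S.inner x y := by
  have key : ∀ z, S.inner (S.inv x) (S.inv y) (S.inv z) = S.inv (S.inner x y z) := fun z => by
    rw [inner_apply]
    apply S.mul_left_cancel (x := S.mul (S.inv y) (S.inv x))
    simp only [S.mul_ld, ← S.inv_mul, inner_apply]
  ext z
  have := key (S.inv z)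
  rwa [S.inv_inv, S.map_inv (S.map_inner x y), S.inv_inv] at this

lemma P_eq (x : Q) : S.P x = S.L x * (S.L (S.inv x))⁻¹ :=
  ((S.L_commute_inv x).inv_right).eq.symm

lemma P_inv (x : Q) : S.P (S.inv x) = (S.P x)⁻¹ := by
  rw [P, S.inv_inv, P, mul_inv_rev, _root_.inv_inv]

lemma P_one : S.P S.one = 1 := by
  rw [P, S.inv_one, inv_mul_cancel]

lemma L_commute_P (x : Q) : Commute (S.L x) (S.P x) :=
  ((S.L_commute_inv x).inv_right).mul_right (Commute.refl _)

lemma P_mul_aux (x y : Q) : S.P (S.mul x y) = S.L x * S.P y * (S.L (S.inv x))⁻¹ := by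
  have h := S.inner_inv y x
  have e1 : S.L (S.mul x y) = S.L x * S.L y * (S.inner y x)⁻¹ := by
    simp only [inner]; group
  have e2 : S.L (S.inv (S.mul x y)) =
      S.L (S.inv x) * S.L (S.inv y) * (S.inner y x)⁻¹ := by
    rw [← h, S.inv_mul]; simp only [inner]; group
  rw [P_eq, e1, e2, P_eq]; group

lemma P_mul (x y : Q) : S.P (S.mul x y) = MulAut.conj (S.L x) (S.P y) * S.P x := by
  rw [P_mul_aux, MulAut.conj_apply, S.P_eq x]; group

lemma P_sq (x : Q) : S.P (S.mul x x) = S.P x * S.P x := by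
  rw [P_mul, MulAut.conj_apply, (S.L_commute_P x).eq, mul_inv_cancel_right]

/-- The Bruck identity. -/
lemma P_P (x y : Q) : S.P (S.P x y) = S.P x * S.P y * S.P x := by
  have h : S.mul (S.inv x) (S.P x y) = S.mul x y := S.mul_ld _ _
  have h1 := S.P_mul_aux (S.inv x) (S.P x y)
  rw [h, P_mul_aux, S.inv_inv] at h1
  have h2 : S.P (S.P x y) =
      (S.L (S.inv x))⁻¹ * (S.L x * S.P y * (S.L (S.inv x))⁻¹) * S.L x := by
    rw [h1]; group
  have e : S.P x = (S.L (S.inv x))⁻¹ * S.L x := rfl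
  rw [h2, e]; group

lemma P_apply_one (x : Q) : S.P x S.one = S.mul x x := by
  change S.ld (S.inv x) (S.mul x S.one) = _
  apply S.mul_left_cancel (x := S.inv x)
  rw [S.mul_ld, S.mul_one]
  have h := congrArg (fun f => f x) (S.L_commute_inv x).eq
  simp only [Equiv.Perm.mul_apply, L_apply] at h
  rw [← h, S.mul_comm (S.inv x), S.mul_inv, S.mul_one]

lemma P_sq_inj (hsq : Function.Injective fun x => S.mul x x) {a b : Q}
    (h : S.P a * S.P a = S.P b * S.P b) : S.P a = S.P b := by
  rw [← P_sq, ← P_sq] at h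
  have h1 := congrArg (fun f => f S.one) h
  simp only [P_apply_one] at h1
  rw [hsq (hsq h1)]

/-- `a` is in the center of the associated Bruck loop. -/
def Central (a : Q) : Prop := ∀ x, Commute (S.P a) (S.P x)

variable {S}

lemma Central.inv {a : Q} (ha : S.Central a) : S.Central (S.inv a) := fun x => by
  rw [P_inv]; exact (ha x).inv_left

lemma Central.commute_conj {a : Q} (ha : S.Central a) (x y : Q) :
    Commute (MulAut.conj (S.L x) (S.P a)) (S.P y) := by
  have h : ∀ z, Commute (MulAut.conj (S.L x) (S.P a)) (S.P (S.mul x z) * (S.P x)⁻¹) := fun z => by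
    rw [P_mul, mul_inv_cancel_right]
    exact (ha z).map (MulAut.conj (S.L x))
  have h1 := h (S.inv x)
  rw [S.mul_inv, P_one, _root_.one_mul, Commute.inv_right_iff] at h1
  have h2 := (h (S.ld x y)).mul_right h1
  rwa [inv_mul_cancel_right, S.mul_ld] at h2

lemma Central.exists_conj (hsq : Function.Surjective fun x => S.mul x x) {a : Q}
    (ha : S.Central a) (x : Q) :
    ∃ b, S.Central b ∧ MulAut.conj (S.L x) (S.P a) = S.P b := by
  suffices ∃ b, MulAut.conj (S.L x) (S.P a) = S.P b by
    obtain ⟨b, hb⟩ := this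
    exact ⟨b, fun y => hb ▸ ha.commute_conj x y, hb⟩
  obtain ⟨s, rfl⟩ := hsq x
  refine ⟨S.P (S.inv s) (S.mul (S.mul s s) a), ?_⟩
  have h := ha.commute_conj (S.mul s s) (S.inv s)
  rw [P_P, P_mul, ← mul_assoc, ← h.eq, P_sq, P_inv]
  group

lemma Central.conj_inv {a : Q} (ha : S.Central a) (x : Q) :
    MulAut.conj (S.L (S.inv x)) (S.P a) = MulAut.conj (S.L x) (S.P a) := by
  have h : S.L (S.inv x) = S.L x * (S.P x)⁻¹ := by
    rw [P]; group
  rw [h, map_mul, MulAut.mul_apply, MulAut.conj_apply (S.P x)⁻¹, ← ((ha x).inv_right).eq]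
  group

lemma Central.conj_mul (hsq : Function.Bijective fun x => S.mul x x) {a b : Q}
    (ha : S.Central a) (hb : S.Central b) (x : Q) :
    MulAut.conj (S.L (S.mul x a)) (S.P b) = MulAut.conj (S.L x) (S.P b) := by
  have key : ∀ a x, S.Central a → MulAut.conj (S.L (S.mul x a)) (S.P b) *
      MulAut.conj (S.L x) (S.P a) =
      MulAut.conj (S.L b) (MulAut.conj (S.L x) (S.P a)) * MulAut.conj (S.L x) (S.P b) := by
    intro a x ha
    have h1 := S.P_mul (S.mul x a) b
    rw [S.mul_comm (S.mul x a), S.P_mul b, S.P_mul x a, map_mul, ← mul_assoc,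
      mul_assoc _ (MulAut.conj (S.L b) (S.P x)), ← S.P_mul b x, S.mul_comm b x, S.P_mul x b,
      ← mul_assoc] at h1
    exact (mul_right_cancel h1).symm
  have k1 := key a x ha
  have k2 := key (S.inv a) (S.inv x) ha.inv
  rw [← S.inv_mul, hb.conj_inv, hb.conj_inv, ha.inv.conj_inv, P_inv, _root_.map_inv,
    _root_.map_inv] at k2
  obtain ⟨c, hc, hC⟩ := ha.exists_conj hsq.2 x
  obtain ⟨d, hd, hD⟩ := hc.exists_conj hsq.2 b
  obtain ⟨e, he, hE⟩ := hb.exists_conj hsq.2 (S.mul x a)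
  obtain ⟨f, hf, hF⟩ := hb.exists_conj hsq.2 x
  rw [hC, hD, hE, hF] at k1 k2
  rw [hE, hF]
  have h2 : S.P c * S.P c = S.P d * S.P d := by
    have e1 : S.P e = S.P d * S.P f * (S.P c)⁻¹ := by rw [← k1]; group
    have e2 : S.P e = (S.P d)⁻¹ * S.P f * S.P c := by rw [← k2]; group
    have e3 : S.P f * S.P d * (S.P c)⁻¹ = S.P f * (S.P d)⁻¹ * S.P c := by
      rw [(hf d).eq, ← e1, e2, ((hf d).inv_right).eq]
    have e4 : S.P d * (S.P c)⁻¹ = (S.P d)⁻¹ * S.P c := by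
      rw [mul_assoc, mul_assoc] at e3
      exact _root_.mul_left_cancel e3
    rw [mul_inv_eq_iff_eq_mul, mul_assoc, eq_inv_mul_iff_mul_eq] at e4
    exact e4.symm
  rw [S.P_sq_inj hsq.1 h2, (hd f).eq] at k1
  exact mul_right_cancel k1

/-- Left translations commute with `P_a` for `a` central in the Bruck loop. -/
lemma Central.commute_L (hsq : Function.Bijective fun x => S.mul x x) {a : Q}
    (ha : S.Central a) (x : Q) : Commute (S.L x) (S.P a) := by
  obtain ⟨z, hz⟩ : ∃ z, z = S.P a x := ⟨_, rfl⟩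
  have hzx : S.mul z (S.inv a) = S.mul x a := by
    rw [hz, S.mul_comm, S.mul_comm x]; exact S.mul_ld _ _
  have hl : MulAut.conj (S.L z) (S.P a) = MulAut.conj (S.L x) (S.P a) := by
    rw [← ha.inv.conj_mul hsq ha z, hzx, ha.conj_mul hsq ha]
  have h1 := S.P_mul z (S.inv a)
  have h2 : S.P z = S.P a * S.P a * S.P x := by
    rw [hz, P_P, mul_assoc, ← (ha x).eq, mul_assoc]
  rw [hzx, P_mul, P_inv, _root_.map_inv, hl, h2, ← mul_assoc] at h1
  have h3 := eq_inv_mul_iff_mul_eq.mp (mul_right_cancel h1)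
  obtain ⟨b, -, hb⟩ := ha.exists_conj hsq.2 x
  rw [hb] at h3
  have h4 := S.P_sq_inj hsq.1 h3
  rw [h4, MulAut.conj_apply, mul_inv_eq_iff_eq_mul] at hb
  exact hb

end CommAutoLoop


/-- **Lemma 4.1.** In a uniquely 2-divisible commutative automorphic loop, if `a` lies in
the center of the associated Bruck loop (i.e. `P_a P_x = P_x P_a` for all `x`,
where `x⁻¹ := x \ 1` and `P_x(y) := x⁻¹ \ (x·y)`), then
`L_{a\x, a}(x) = L_{a\x⁻¹, a}(x)` for all `x`, where `L_{u,v}(z) = (v·u)\(v·(u·z))`. -/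
theorem bruck_central_L_adx_a_eq_L_adxinv_a
    (Q : Type) (mul ld : Q → Q → Q) (one : Q)
    (hld1 : ∀ x y : Q, ld x (mul x y) = y)
    (hld2 : ∀ x y : Q, mul x (ld x y) = y)
    (hone1 : ∀ x : Q, mul one x = x)
    (hone2 : ∀ x : Q, mul x one = x)
    (hcomm : ∀ x y : Q, mul x y = mul y x)
    (hauto : ∀ x y u v : Q,
      ld (mul y x) (mul y (mul x (mul u v))) =
        mul (ld (mul y x) (mul y (mul x u))) (ld (mul y x) (mul y (mul x v))))
    (hsq : Function.Bijective (fun x : Q => mul x x))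
    (a : Q)
    (ha : ∀ x y : Q, ld (ld a one) (mul a (ld (ld x one) (mul x y))) =
      ld (ld x one) (mul x (ld (ld a one) (mul a y)))) :
    ∀ x : Q, ld x (mul a (mul (ld a x) x)) =
      ld (ld x one) (mul a (mul (ld a (ld x one)) x)) := by
  intro x
  let S : CommAutoLoop Q := ⟨mul, ld, one, hld1, hld2, hone1, hcomm, hauto⟩
  have hc : S.Central a := fun x => Equiv.ext (ha x)
  have h1 := S.inner_inv (ld a (S.inv x)) a
  have h2 : S.inv (ld a (S.inv x)) = ld (S.inv a) x := by
    apply S.mul_left_cancel (x := S.inv a)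
    rw [← S.inv_mul]
    change S.inv (mul a (ld a (S.inv x))) = mul _ (ld _ x)
    rw [hld2, hld2, S.inv_inv]
  have h3 := congrArg (fun f => f x) h1
  rw [h2] at h3
  change ld (mul (S.inv a) (ld (S.inv a) x)) (mul (S.inv a) (mul (ld (S.inv a) x) x)) =
    ld (mul a (ld a (S.inv x))) (mul a (mul (ld a (S.inv x)) x)) at h3
  rw [hld2, hld2] at h3
  have h4 := congrArg (fun f => f (ld a x)) (hc.commute_L hsq x).eq
  change mul x (ld (S.inv a) (mul a (ld a x))) = ld (S.inv a) (mul a (mul x (ld a x))) at h4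
  rw [hld2] at h4
  refine Eq.trans ?_ h3
  rw [hcomm (ld a x), hcomm (ld (S.inv a) x), h4, hld2]
end

section
/- Let (Q,·,\,1) be a uniquely 2-divisible commutative automorphic loop and let a ∈ Q satisfy P_a(P_x(y)) = P_x(P_a(y)) for all x,y ∈ Q (i.e., a lies in the center of the associated Bruck loop). Then for all x ∈ Q, L_{a\x⁻¹, a}(a\x) = (x\a)⁻¹; explicitly, x⁻¹ \ ( a·((a\x⁻¹)·(a\x)) ) = (x\a)\1. -/
/-- A commutative automorphic loop; `x \ y` denotes left division. -/
class CommAutomorphicLoop (Q : Type*) extends Mul Q, One Q, SDiff Q where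
  sdiff_mul_cancel (x y : Q) : x \ (x * y) = y
  mul_sdiff_cancel (x y : Q) : x * (x \ y) = y
  one_mul' (x : Q) : 1 * x = x
  mul_comm' (x y : Q) : x * y = y * x
  inner_mul' (x y u v : Q) : (y * x) \ (y * (x * (u * v))) =
    ((y * x) \ (y * (x * u))) * ((y * x) \ (y * (x * v)))

namespace CommAutomorphicLoop

variable {Q : Type*} [CommAutomorphicLoop Q]

instance : Inv Q := ⟨fun x => x \ 1⟩

/-- The inner mapping `L_{x,y}`. -/
def inner (x y z : Q) : Q := (y * x) \ (y * (x * z))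

/-- The mapping `P_x = L_{x⁻¹}⁻¹ L_x`. -/
def P (x y : Q) : Q := x⁻¹ \ (x * y)

lemma one_mul (x : Q) : 1 * x = x := one_mul' x

lemma mul_comm (x y : Q) : x * y = y * x := mul_comm' x y

lemma mul_one (x : Q) : x * 1 = x := by rw [mul_comm, one_mul]

lemma sdiff_eq {x y z : Q} (h : y = x * z) : x \ y = z := by
  rw [h, sdiff_mul_cancel]

lemma mul_inv_self (x : Q) : x * x⁻¹ = 1 := mul_sdiff_cancel x 1

lemma inv_mul_self (x : Q) : x⁻¹ * x = 1 := by rw [mul_comm, mul_inv_self]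

lemma inv_eq {x y : Q} (h : x * y = 1) : x⁻¹ = y := sdiff_eq h.symm

lemma inv_inv (x : Q) : x⁻¹⁻¹ = x := inv_eq (inv_mul_self x)

lemma one_inv : (1 : Q)⁻¹ = 1 := inv_eq (one_mul 1)

lemma mul_inner (x y z : Q) : (y * x) * inner x y z = y * (x * z) := mul_sdiff_cancel _ _

lemma inner_mul (x y u v : Q) : inner x y (u * v) = inner x y u * inner x y v :=
  inner_mul' x y u v

lemma inner_one (x y : Q) : inner x y 1 = 1 := by
  unfold inner
  exact sdiff_eq (by rw [mul_one, mul_one])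

lemma inner_inv (x y z : Q) : inner x y z⁻¹ = (inner x y z)⁻¹ :=
  (inv_eq (by rw [← inner_mul, mul_inv_self, inner_one])).symm

lemma inner_right (x y : Q) : inner x y y = y :=
  sdiff_eq (by rw [mul_comm x y, mul_comm y (y * x)])

lemma inner_right_inv (x y : Q) : inner x y y⁻¹ = y⁻¹ := by rw [inner_inv, inner_right]

lemma inv_mul_mul (x y : Q) : x⁻¹ * (x * y) = x * (x⁻¹ * y) := by
  have h := mul_inner y x x⁻¹
  rw [inner_right_inv] at h
  rw [mul_comm, h, mul_comm y]

/-- The automorphic inverse property. -/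
lemma mul_inv (x y : Q) : (x * y)⁻¹ = x⁻¹ * y⁻¹ := by
  obtain ⟨u, hu⟩ : ∃ u, x = (x * y) * u := ⟨_, (mul_sdiff_cancel _ x).symm⟩
  generalize hv : x * y = v at hu ⊢
  subst hu
  have h₁ : inner u v u⁻¹ = y := sdiff_eq (by rw [mul_inv_self, mul_one, hv])
  have h₂ : inner u v (u \ v⁻¹) = (v * u)⁻¹ := by
    unfold inner
    rw [mul_sdiff_cancel, mul_inv_self]
    rfl
  have h₃ : inner u v u = y⁻¹ := by rw [← h₁, ← inner_inv, inv_inv]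
  rw [← h₂, ← h₃, mul_comm, ← inner_mul, mul_sdiff_cancel, inner_right_inv]

lemma sdiff_inv (x y : Q) : (x \ y)⁻¹ = x⁻¹ \ y⁻¹ :=
  (sdiff_eq (by rw [← mul_inv, mul_sdiff_cancel])).symm

lemma inner_inv_inv (x y z : Q) : inner x⁻¹ y⁻¹ z = inner x y z := by
  have h : inner x y z = (inner x y z⁻¹)⁻¹ := by rw [inner_inv, inv_inv]
  rw [h]
  simp only [inner, sdiff_inv, mul_inv, inv_inv]

lemma inv_mul_P (x y : Q) : x⁻¹ * P x y = x * y := mul_sdiff_cancel _ _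

lemma P_eq {x y z : Q} (h : x * y = x⁻¹ * z) : P x y = z := sdiff_eq h

lemma P_mul (x y z : Q) : P (x * y) (x⁻¹ * z) = x * P y z := by
  obtain ⟨t, rfl⟩ : ∃ t, z = y⁻¹ * t := ⟨_, (mul_sdiff_cancel _ z).symm⟩
  have hy : P y (y⁻¹ * t) = y * t := P_eq (inv_mul_mul y t).symm
  have h' : (x * y) * inner y x t = x * (y * t) := mul_inner y x t
  have h'' := mul_inner y⁻¹ x⁻¹ t
  rw [inner_inv_inv, ← mul_inv] at h''
  rw [hy, ← h', ← h'']
  exact P_eq (inv_mul_mul _ _).symm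

/-- The twisted subgroup property `P_x P_y P_x = P_{P_x(y)}`. -/
lemma P_P (x y z : Q) : P (P x y) z = P x (P y (P x z)) := by
  refine (P_eq ?_).symm
  rw [← P_mul, inv_mul_P]
  have h := P_mul x⁻¹ (P x y) z
  rwa [inv_inv, inv_mul_P] at h

lemma P_inv_P (x z : Q) : P x⁻¹ (P x z) = z := P_eq (by rw [inv_mul_P, inv_inv])

lemma P_P_inv (x z : Q) : P x (P x⁻¹ z) = z := by
  simpa only [inv_inv] using P_inv_P x⁻¹ z

lemma P_one_left (z : Q) : P 1 z = z := P_eq (by rw [one_inv])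

lemma P_one_right (x : Q) : P x 1 = x * x :=
  P_eq (by rw [inv_mul_mul, inv_mul_self])

lemma P_sq (x z : Q) : P (x * x) z = P x (P x z) := by
  rw [← P_one_right, P_P, P_one_left]

lemma inv_P (x y : Q) : (P x y)⁻¹ = P x⁻¹ y⁻¹ := by
  simp only [P, sdiff_inv, mul_inv]

lemma P_inv_mul (x y : Q) : P x (x⁻¹ * y) = x * y := P_eq (inv_mul_mul x y).symm

lemma mul_eq_of_P_P (hsq : Function.Bijective fun x : Q => x * x) {u v c : Q}
    (huv : ∀ z, P u (P v z) = P c z) (hvu : ∀ z, P v (P u z) = P c z) : u * v = c := by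
  have h₁ (t : Q) : P (u * v) t = P v (P (u * v⁻¹) (P v t)) := by
    rw [← P_P, mul_comm u v⁻¹, P_inv_mul, mul_comm]
  have h₂ (s : Q) : P (u * v⁻¹) s = P u (P (u * v)⁻¹ (P u s)) := by
    rw [← P_P, mul_inv, P_inv_mul]
  have h₃ : u * v = P c (u * v)⁻¹ := by
    apply hsq.1
    change (u * v) * (u * v) = P c (u * v)⁻¹ * P c (u * v)⁻¹
    rw [← P_one_right, ← P_one_right, h₁, h₂, hvu, huv, P_P]
  obtain ⟨d, rfl⟩ := hsq.2 c
  change u * v = P (d * d) _ at h₃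
  rw [P_sq] at h₃
  have h₄ : (P d (u * v)⁻¹)⁻¹ = P d (u * v)⁻¹ := by
    rw [inv_P, inv_inv]
    conv_lhs => rw [h₃, P_inv_P]
  have h₅ : P d (u * v)⁻¹ = 1 := by
    apply hsq.1
    change P d (u * v)⁻¹ * P d (u * v)⁻¹ = 1 * 1
    conv_lhs => arg 2; rw [← h₄]
    rw [mul_inv_self, one_mul]
  rw [h₃, h₅, P_one_right]

lemma P_mul_of_central (hsq : Function.Bijective fun x : Q => x * x) {a : Q}
    (ha : ∀ x y : Q, P a (P x y) = P x (P a y)) (y z : Q) :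
    P (a * y) z = P a (P y z) := by
  obtain ⟨r, rfl⟩ := hsq.2 y
  change P (a * (r * r)) z = P a (P (r * r) z)
  have h (z : Q) : P a (P (r * r) z) = P (P r a) z := by rw [P_P, P_sq, ha, ha]
  rw [mul_eq_of_P_P hsq h fun z => by rw [← ha, h], h]

lemma mul_mul_mul_inv_of_central (hsq : Function.Bijective fun x : Q => x * x) {a : Q}
    (ha : ∀ x y : Q, P a (P x y) = P x (P a y)) (y : Q) :
    (a * y) * (a * y⁻¹) = a * a := by
  apply mul_eq_of_P_P hsq <;> intro z
  · simp only [P_mul_of_central hsq ha]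
    rw [← ha, P_P_inv]
  · simp only [P_mul_of_central hsq ha]
    rw [← ha, P_inv_P]

lemma sdiff_mul_sdiff_inv_of_central (hsq : Function.Bijective fun x : Q => x * x) {a : Q}
    (ha : ∀ x y : Q, P a (P x y) = P x (P a y)) (x : Q) :
    (a \ x⁻¹) * (a \ x) = a⁻¹ * a⁻¹ := by
  have ha' (x y : Q) : P a⁻¹ (P x y) = P x (P a⁻¹ y) := by
    conv_lhs => rw [← P_P_inv a y, ← ha, P_inv_P]
  obtain ⟨y, hy⟩ : ∃ y, a \ x = a⁻¹ * y := ⟨_, (mul_sdiff_cancel _ _).symm⟩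
  have hx : x = a * (a⁻¹ * y) := by rw [← hy, mul_sdiff_cancel]
  have hy' : a \ x⁻¹ = a⁻¹ * y⁻¹ := by
    apply sdiff_eq
    rw [hx, mul_inv, mul_inv, inv_inv, inv_mul_mul]
  rw [hy, hy', mul_comm, mul_mul_mul_inv_of_central hsq ha']

lemma inner_sdiff_inv_of_central (hsq : Function.Bijective fun x : Q => x * x) {a : Q}
    (ha : ∀ x y : Q, P a (P x y) = P x (P a y)) (x : Q) :
    x⁻¹ \ (a * ((a \ x⁻¹) * (a \ x))) = (x \ a)⁻¹ := by
  rw [sdiff_mul_sdiff_inv_of_central hsq ha, ← inv_mul_mul, mul_inv_self, mul_one, sdiff_inv]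

end CommAutomorphicLoop


/-- **Lemma 4.2, equation (4.4).** In a uniquely 2-divisible commutative automorphic
loop, if `a` lies in the center of the associated Bruck loop (i.e. `P_a P_x = P_x P_a`
for all `x`, where `x⁻¹ := x \ 1` and `P_x(y) := x⁻¹ \ (x·y)`), then
`L_{a\x⁻¹, a}(a\x) = (x\a)⁻¹` for all `x`, where `L_{u,v}(z) = (v·u)\(v·(u·z))`. -/
theorem bruck_central_L_eval_adiv_eq_inv
    (Q : Type) (mul ld : Q → Q → Q) (one : Q)
    (hld1 : ∀ x y : Q, ld x (mul x y) = y)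
    (hld2 : ∀ x y : Q, mul x (ld x y) = y)
    (hone1 : ∀ x : Q, mul one x = x)
    (hone2 : ∀ x : Q, mul x one = x)
    (hcomm : ∀ x y : Q, mul x y = mul y x)
    (hauto : ∀ x y u v : Q,
      ld (mul y x) (mul y (mul x (mul u v))) =
        mul (ld (mul y x) (mul y (mul x u))) (ld (mul y x) (mul y (mul x v))))
    (hsq : Function.Bijective (fun x : Q => mul x x))
    (a : Q)
    (ha : ∀ x y : Q, ld (ld a one) (mul a (ld (ld x one) (mul x y))) =
      ld (ld x one) (mul x (ld (ld a one) (mul a y)))) :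
    ∀ x : Q, ld (ld x one) (mul a (mul (ld a (ld x one)) (ld a x))) =
      ld (ld x a) one := by
  let _ : CommAutomorphicLoop Q :=
    { mul := mul, one := one, sdiff := ld, sdiff_mul_cancel := hld1, mul_sdiff_cancel := hld2
      one_mul' := hone1, mul_comm' := hcomm, inner_mul' := hauto }
  exact CommAutomorphicLoop.inner_sdiff_inv_of_central hsq ha
end

section
/- Let (Q,·,\,1) be a uniquely 2-divisible commutative automorphic loop and let a ∈ Q satisfy P_a(P_x(y)) = P_x(P_a(y)) for all x,y ∈ Q (i.e., a lies in the center of the associated Bruck loop). Then P_{x·a} = P_x followed by P_a: for all x,y ∈ Q, (x·a)⁻¹ \ ( (x·a)·y ) = a⁻¹ \ ( a·( x⁻¹ \ (x·y) ) ). -/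
/-- The laws of a commutative automorphic loop, with left division `ld` and identity `one`. -/
structure IsCommAutomorphicLoop {Q : Type*} (mul ld : Q → Q → Q) (one : Q) : Prop where
  ld_mul : ∀ x y, ld x (mul x y) = y
  mul_ld : ∀ x y, mul x (ld x y) = y
  mul_one : ∀ x, mul x one = x
  comm : ∀ x y, mul x y = mul y x
  auto : ∀ x y u v,
    ld (mul y x) (mul y (mul x (mul u v))) =
      mul (ld (mul y x) (mul y (mul x u))) (ld (mul y x) (mul y (mul x v)))

namespace IsCommAutomorphicLoop

variable {Q : Type*} {mul ld : Q → Q → Q} {one : Q}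

/-- The left translation by `x`, as a permutation. -/
def left (h : IsCommAutomorphicLoop mul ld one) (x : Q) : Equiv.Perm Q where
  toFun := mul x
  invFun := ld x
  left_inv := h.ld_mul x
  right_inv := h.mul_ld x

/-- The inner mapping `z ↦ (x·y) \ (x·(y·z))`. -/
def inner (h : IsCommAutomorphicLoop mul ld one) (x y : Q) : Equiv.Perm Q :=
  (h.left (mul x y))⁻¹ * (h.left x * h.left y)

/-- The permutation `P_x : y ↦ x⁻¹ \ (x·y)`. -/
def P (h : IsCommAutomorphicLoop mul ld one) (x : Q) : Equiv.Perm Q :=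
  (h.left (ld x one))⁻¹ * h.left x

theorem left_apply (h : IsCommAutomorphicLoop mul ld one) (x y : Q) :
    h.left x y = mul x y := rfl

theorem inner_apply (h : IsCommAutomorphicLoop mul ld one) (x y z : Q) :
    h.inner x y z = ld (mul x y) (mul x (mul y z)) := rfl

theorem P_apply (h : IsCommAutomorphicLoop mul ld one) (x y : Q) :
    h.P x y = ld (ld x one) (mul x y) := rfl

theorem ld_eq_of_mul_eq (h : IsCommAutomorphicLoop mul ld one) {x y z : Q}
    (hxy : mul x y = z) : ld x z = y := by
  rw [← hxy, h.ld_mul]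

theorem inv_mul (h : IsCommAutomorphicLoop mul ld one) (x : Q) : mul (ld x one) x = one := by
  rw [h.comm, h.mul_ld]

theorem inv_inv (h : IsCommAutomorphicLoop mul ld one) (x : Q) : ld (ld x one) one = x :=
  h.ld_eq_of_mul_eq (h.inv_mul x)

theorem inner_mul (h : IsCommAutomorphicLoop mul ld one) (x y u v : Q) :
    h.inner x y (mul u v) = mul (h.inner x y u) (h.inner x y v) :=
  h.auto y x u v

theorem inner_one (h : IsCommAutomorphicLoop mul ld one) (x y : Q) :
    h.inner x y one = one := by
  rw [inner_apply, h.mul_one]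
  exact h.ld_eq_of_mul_eq (h.mul_one _)

theorem inner_inv (h : IsCommAutomorphicLoop mul ld one) (x y u : Q) :
    h.inner x y (ld u one) = ld (h.inner x y u) one := by
  refine (h.ld_eq_of_mul_eq ?_).symm
  rw [← h.inner_mul, h.mul_ld, h.inner_one]

theorem inner_mul_left (h : IsCommAutomorphicLoop mul ld one) (x y u : Q) :
    h.inner x y * h.left u = h.left (h.inner x y u) * h.inner x y :=
  Equiv.ext fun v => h.inner_mul x y u v

theorem left_one (h : IsCommAutomorphicLoop mul ld one) : h.left one = 1 :=
  Equiv.ext fun x => (h.comm one x).trans (h.mul_one x)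

theorem commute_left_left_inv (h : IsCommAutomorphicLoop mul ld one) (x : Q) :
    Commute (h.left x) (h.left (ld x one)) := by
  have hin : h.inner (ld x one) x = h.left (ld x one) * h.left x := by
    rw [inner, h.inv_mul, h.left_one, inv_one, one_mul]
  have hfix : h.inner (ld x one) x (ld x one) = ld x one := by
    rw [hin, Equiv.Perm.mul_apply, left_apply, left_apply, h.mul_ld, h.mul_one]
  have hfix' : h.inner (ld x one) x x = x := by
    have := h.inner_inv (ld x one) x (ld x one)
    rwa [hfix, h.inv_inv] at this
  have hc := h.inner_mul_left (ld x one) x x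
  rw [hfix', hin, ← mul_assoc] at hc
  exact (mul_right_cancel hc).symm

theorem mul_mul_inv (h : IsCommAutomorphicLoop mul ld one) (x y : Q) :
    mul x (mul (ld x one) y) = mul (ld x one) (mul x y) :=
  DFunLike.congr_fun (h.commute_left_left_inv x).eq y

theorem inner_inv_left (h : IsCommAutomorphicLoop mul ld one) (x y : Q) :
    h.inner x y (ld x one) = ld x one := by
  refine h.ld_eq_of_mul_eq ?_
  change _ = mul x (mul y (ld x one))
  rw [h.comm y, h.mul_mul_inv, h.comm]

/-- The automorphic inverse property. -/
theorem mul_inv_inv (h : IsCommAutomorphicLoop mul ld one) (u w : Q) :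
    mul (ld u one) (ld w one) = ld (mul u w) one := by
  set x := mul u w with hx
  set y := ld x u with hy
  have hxy : mul x y = u := h.mul_ld x u
  have hy' : h.inner x y y = ld w one := by
    have : h.inner x y (ld y one) = w := by
      rw [inner_apply, hxy, h.mul_ld, h.mul_one, hx, h.ld_mul]
    rw [← this, h.inner_inv, h.inv_inv]
  have hq : h.inner x y (ld y (ld x one)) = ld u one := by
    rw [inner_apply, hxy, h.mul_ld, h.mul_ld]
  rw [← hy', ← hq, h.comm, ← h.inner_mul, h.mul_ld, h.inner_inv_left]

theorem ld_inv_inv (h : IsCommAutomorphicLoop mul ld one) (u w : Q) :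
    ld (ld u one) (ld w one) = ld (ld u w) one := by
  refine h.ld_eq_of_mul_eq ?_
  rw [h.mul_inv_inv, h.mul_ld]

theorem inner_inv_inv (h : IsCommAutomorphicLoop mul ld one) (x y : Q) :
    h.inner (ld x one) (ld y one) = h.inner x y := by
  ext z
  conv_lhs => rw [← h.inv_inv z]
  rw [inner_apply, h.mul_inv_inv, h.mul_inv_inv, h.mul_inv_inv, h.ld_inv_inv, ← h.inner_apply,
    h.inner_inv, h.inv_inv]

theorem P_eq (h : IsCommAutomorphicLoop mul ld one) (x : Q) :
    h.P x = h.left x * (h.left (ld x one))⁻¹ :=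
  (h.commute_left_left_inv x).inv_right.eq.symm

theorem commute_P_left (h : IsCommAutomorphicLoop mul ld one) (x : Q) :
    Commute (h.P x) (h.left x) :=
  (h.commute_left_left_inv x).symm.inv_left.mul_left (Commute.refl _)

theorem P_inv (h : IsCommAutomorphicLoop mul ld one) (x : Q) :
    h.P (ld x one) = (h.P x)⁻¹ := by
  rw [h.P_eq x, h.P_eq, h.inv_inv, mul_inv_rev, _root_.inv_inv]

theorem P_mul (h : IsCommAutomorphicLoop mul ld one) (x y : Q) :
    h.P (mul x y) = h.left x * h.P y * (h.left (ld x one))⁻¹ := by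
  have hin := h.inner_inv_inv x y
  rw [inner, inner, h.mul_inv_inv] at hin
  rw [h.P_eq y, h.P_eq]
  generalize h.left (ld (mul x y) one) = U' at *
  generalize h.left (mul x y) = U at *
  have : U = h.left x * h.left y * (U'⁻¹ * (h.left (ld x one) * h.left (ld y one)))⁻¹ := by
    rw [hin]; group
  rw [this]; group

theorem P_P (h : IsCommAutomorphicLoop mul ld one) (x y : Q) :
    h.P (h.P x y) = h.P x * h.P y * h.P x := by
  have e : mul (ld x one) (h.P x y) = mul x y := h.mul_ld _ _
  have h1 := h.P_mul (ld x one) (h.P x y)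
  rw [e, h.P_mul, h.inv_inv] at h1
  have h2 : h.P (h.P x y) = (h.left (ld x one))⁻¹ *
      (h.left (ld x one) * h.P (h.P x y) * (h.left x)⁻¹) * h.left x := by group
  rw [h2, ← h1]
  simp only [P, mul_assoc]

theorem P_one (h : IsCommAutomorphicLoop mul ld one) : h.P one = 1 := by
  rw [P, h.ld_eq_of_mul_eq (h.mul_one one), h.left_one, inv_one, one_mul]

theorem P_apply_one (h : IsCommAutomorphicLoop mul ld one) (x : Q) :
    h.P x one = mul x x := by
  refine h.ld_eq_of_mul_eq ?_
  rw [← h.mul_mul_inv, h.inv_mul, left_apply]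

theorem P_sq (h : IsCommAutomorphicLoop mul ld one) (x : Q) :
    h.P (mul x x) = h.P x * h.P x := by
  rw [← h.P_apply_one, h.P_P, h.P_one, _root_.mul_one]

theorem P_mul_eq_P_mul_inv (h : IsCommAutomorphicLoop mul ld one) (x y : Q) :
    h.P (mul x y) = h.P y * h.P (mul x (ld y one)) * h.P y := by
  rw [← h.P_P, P_apply]
  congr 1
  refine (h.ld_eq_of_mul_eq ?_).symm
  rw [h.comm x (ld y one), h.mul_mul_inv, h.comm x]

theorem P_mul_mul_self_of_commute (h : IsCommAutomorphicLoop mul ld one) {a x : Q}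
    (hax : Commute (h.P a) (h.P x)) (haxa : Commute (h.P a) (h.P (mul x a))) :
    h.P (mul x a) * h.P (mul x a) = h.P x * h.P a * (h.P x * h.P a) := by
  set M := h.left x * h.P a * (h.left x)⁻¹ with hM
  have hMx : Commute (h.P x) M :=
    ((h.commute_P_left x).mul_right hax.symm).mul_right (h.commute_P_left x).inv_right
  have h1 : h.P (mul x a) = M * h.P x := by
    rw [h.P_mul, h.P_eq x, hM]; group
  have h2 : h.P (mul x (ld a one)) = M⁻¹ * h.P x := by
    rw [h.P_mul, h.P_inv, h.P_eq x, hM]; group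
  have h3 : h.P (mul x (ld a one)) * h.P (mul x a) = h.P x * h.P x := by
    rw [h1, h2, ← hMx.eq, mul_assoc, ← mul_assoc (h.P x), hMx.mul_left hMx |>.eq]
    group
  calc h.P (mul x a) * h.P (mul x a)
      = h.P a * (h.P (mul x (ld a one)) * (h.P a * h.P (mul x a))) := by
        conv_lhs => enter [1]; rw [h.P_mul_eq_P_mul_inv]
        simp only [mul_assoc]
    _ = h.P a * (h.P x * h.P x) * h.P a := by
        rw [haxa.eq, ← mul_assoc (h.P (mul x (ld a one))), h3]; simp only [mul_assoc]
    _ = h.P x * h.P a * (h.P x * h.P a) := by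
        rw [← mul_assoc (h.P a), hax.eq]; simp only [mul_assoc]

theorem P_mul_of_commute (h : IsCommAutomorphicLoop mul ld one)
    (hsq : Function.Bijective fun x : Q => mul x x) {a : Q}
    (ha : ∀ x, Commute (h.P a) (h.P x)) (x : Q) :
    h.P (mul x a) = h.P x * h.P a := by
  obtain ⟨r, rfl⟩ := hsq.2 x
  have hw : h.P (h.P r a) = h.P (mul r r) * h.P a := by
    rw [h.P_P, h.P_sq, mul_assoc, mul_assoc, (ha r).eq]
  have hP : h.P (mul (mul (mul r r) a) (mul (mul r r) a)) =
      h.P (mul (h.P r a) (h.P r a)) := by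
    rw [h.P_sq, h.P_sq, hw, h.P_mul_mul_self_of_commute (ha _) (ha _)]
  have hs : mul (mul (mul (mul r r) a) (mul (mul r r) a))
      (mul (mul (mul r r) a) (mul (mul r r) a)) =
      mul (mul (h.P r a) (h.P r a)) (mul (h.P r a) (h.P r a)) := by
    rw [← h.P_apply_one, hP, h.P_apply_one]
  change h.P (mul (mul r r) a) = _
  rw [← hw, hsq.1 (hsq.1 hs)]

end IsCommAutomorphicLoop


/-- **Lemma 4.4.** In a uniquely 2-divisible commutative automorphic loop, if `a`
lies in the center of the associated Bruck loop (i.e. `P_a P_x = P_x P_a` for all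
`x`, where `x⁻¹ := x \ 1` and `P_x(y) := x⁻¹ \ (x·y)`), then `P_{x·a} = P_x P_a`:
`(x·a)⁻¹ \ ((x·a)·y) = a⁻¹ \ (a·(x⁻¹ \ (x·y)))` for all `x, y`. -/
theorem bruck_central_P_mul_eq_comp
    (Q : Type) (mul ld : Q → Q → Q) (one : Q)
    (hld1 : ∀ x y : Q, ld x (mul x y) = y)
    (hld2 : ∀ x y : Q, mul x (ld x y) = y)
    (hone1 : ∀ x : Q, mul one x = x)
    (hone2 : ∀ x : Q, mul x one = x)
    (hcomm : ∀ x y : Q, mul x y = mul y x)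
    (hauto : ∀ x y u v : Q,
      ld (mul y x) (mul y (mul x (mul u v))) =
        mul (ld (mul y x) (mul y (mul x u))) (ld (mul y x) (mul y (mul x v))))
    (hsq : Function.Bijective (fun x : Q => mul x x))
    (a : Q)
    (ha : ∀ x y : Q, ld (ld a one) (mul a (ld (ld x one) (mul x y))) =
      ld (ld x one) (mul x (ld (ld a one) (mul a y)))) :
    ∀ x y : Q, ld (ld (mul x a) one) (mul (mul x a) y) =
      ld (ld a one) (mul a (ld (ld x one) (mul x y))) := by
  have h : IsCommAutomorphicLoop mul ld one := ⟨hld1, hld2, hone2, hcomm, hauto⟩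
  have hcom : ∀ x, Commute (h.P a) (h.P x) := fun x => Equiv.ext fun y => ha x y
  intro x y
  have hP := (h.P_mul_of_commute hsq hcom x).trans (hcom x).eq.symm
  exact DFunLike.congr_fun hP y
end

section
/- Let (Q,·,\,1) be a uniquely 2-divisible commutative automorphic loop and let a ∈ Q satisfy P_a(P_x(y)) = P_x(P_a(y)) for all x,y ∈ Q (i.e., a lies in the center of the associated Bruck loop). Then a·a lies in the center of (Q,·): for all x,y ∈ Q, (x·y)·(a·a) = x·(y·(a·a)). -/
/-- A commutative automorphic loop with identity `e`, presented by its translations `L`. -/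
structure IsCommAutLoop {Q : Type} (L : Q → Equiv.Perm Q) (e : Q) : Prop where
  one : L e = 1
  comm (x y : Q) : L x y = L y x
  aut (x y u : Q) : ((L (L y x))⁻¹ * (L y * L x)) * L u =
    L (((L (L y x))⁻¹ * (L y * L x)) u) * ((L (L y x))⁻¹ * (L y * L x))

namespace IsCommAutLoop

variable {Q : Type} {L : Q → Equiv.Perm Q} {e : Q}

/-- A permutation is an automorphism of the loop when it intertwines the translations. -/
def IsAut (L : Q → Equiv.Perm Q) (φ : Equiv.Perm Q) : Prop :=
  ∀ u, φ * L u = L (φ u) * φ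

/-- The inverse `x⁻¹ = x \ e`. -/
def inv (L : Q → Equiv.Perm Q) (e x : Q) : Q := (L x)⁻¹ e

/-- The map `P_x(y) = x⁻¹ \ (x * y)`. -/
def P (L : Q → Equiv.Perm Q) (e x : Q) : Equiv.Perm Q := (L (inv L e x))⁻¹ * L x

theorem apply_inv_apply (φ : Equiv.Perm Q) (x : Q) : φ (φ⁻¹ x) = x := φ.apply_symm_apply x

theorem IsAut.mul {φ ψ : Equiv.Perm Q} (hφ : IsAut L φ) (hψ : IsAut L ψ) :
    IsAut L (φ * ψ) := fun u => by
  rw [mul_assoc, hψ, ← mul_assoc, hφ, mul_assoc, Equiv.Perm.mul_apply]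

theorem IsAut.symm {φ : Equiv.Perm Q} (hφ : IsAut L φ) : IsAut L φ⁻¹ := fun u => by
  have h := hφ (φ⁻¹ u)
  rw [apply_inv_apply] at h
  rw [inv_mul_eq_iff_eq_mul, ← mul_assoc, h, mul_inv_cancel_right]

theorem IsAut.map_mul {φ : Equiv.Perm Q} (hφ : IsAut L φ) (u v : Q) :
    φ (L u v) = L (φ u) (φ v) :=
  congrArg (fun f : Equiv.Perm Q => f v) (hφ u)

theorem IsAut.commute {φ : Equiv.Perm Q} (hφ : IsAut L φ) {u : Q} (hu : φ u = u) :
    φ * L u = L u * φ := by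
  have h := hφ u
  rwa [hu] at h

theorem one_mul_apply (h : IsCommAutLoop L e) (x : Q) : L e x = x := by
  rw [h.one, Equiv.Perm.one_apply]

theorem mul_one_apply (h : IsCommAutLoop L e) (x : Q) : L x e = x := by
  rw [h.comm, h.one_mul_apply]

theorem mul_inv (x : Q) : L x (inv L e x) = e := (L x).apply_symm_apply e

theorem inv_mul (h : IsCommAutLoop L e) (x : Q) : L (inv L e x) x = e := by
  rw [h.comm, mul_inv]

theorem eq_inv {x y : Q} (hxy : L x y = e) : y = inv L e x :=
  (L x).injective (hxy.trans (mul_inv x).symm)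

theorem inv_inv (h : IsCommAutLoop L e) (x : Q) : inv L e (inv L e x) = x :=
  (eq_inv (h.inv_mul x)).symm

theorem IsAut.map_one (h : IsCommAutLoop L e) {φ : Equiv.Perm Q} (hφ : IsAut L φ) : φ e = e := by
  have h1 := hφ.map_mul e e
  rw [h.mul_one_apply] at h1
  exact (L (φ e)).injective (h1.symm.trans (h.mul_one_apply _).symm)

theorem IsAut.map_inv (h : IsCommAutLoop L e) {φ : Equiv.Perm Q} (hφ : IsAut L φ) (x : Q) :
    φ (inv L e x) = inv L e (φ x) := by
  apply eq_inv
  rw [← hφ.map_mul, mul_inv, hφ.map_one h]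

theorem isAut_inner (h : IsCommAutLoop L e) (x y : Q) :
    IsAut L ((L (L y x))⁻¹ * (L y * L x)) := h.aut x y

theorem isAut_mul_inv (h : IsCommAutLoop L e) (x : Q) : IsAut L (L x * L (inv L e x)) := by
  have h1 := h.isAut_inner (inv L e x) x
  rwa [mul_inv, h.one, inv_one, one_mul] at h1

theorem mul_inv_fixes (h : IsCommAutLoop L e) (x : Q) : (L x * L (inv L e x)) x = x := by
  rw [Equiv.Perm.mul_apply, h.inv_mul, h.mul_one_apply]

theorem commute_inv (h : IsCommAutLoop L e) (x : Q) :
    L (inv L e x) * L x = L x * L (inv L e x) := by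
  have h1 := (h.isAut_mul_inv x).commute (h.mul_inv_fixes x)
  rw [mul_assoc] at h1
  exact mul_left_cancel h1

/-- The automorphic inverse property. -/
theorem inv_mul_distrib (h : IsCommAutLoop L e) (x y : Q) :
    inv L e (L x y) = L (inv L e x) (inv L e y) := by
  have hφ := h.isAut_inner y x
  set z := L x y with hz
  set φ := (L z)⁻¹ * (L x * L y) with hφ_def
  have hzφ (u : Q) : L z (φ u) = L x (L y u) := by
    simp [hφ_def, Equiv.Perm.mul_apply]
  obtain ⟨w, hw⟩ := (L y).surjective (inv L e x)
  have hφw : φ w = inv L e z := by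
    apply eq_inv
    rw [hzφ, hw, mul_inv]
  have hzp : L z (φ (inv L e y)) = x := by
    rw [hzφ, mul_inv, h.mul_one_apply]
  have h1 : (L x * L (inv L e x)) y = (L z * L (inv L e z)) (φ y) := by
    have h2 := hzφ (inv L e x)
    conv at h2 => lhs; rw [← hw, hφ.map_mul, hφw, h.comm (φ y)]
    rw [Equiv.Perm.mul_apply, Equiv.Perm.mul_apply, h2, h.comm y]
  have h3 := congrArg (inv L e) h1
  rw [← (h.isAut_mul_inv x).map_inv h, ← (h.isAut_mul_inv z).map_inv h, ← hφ.map_inv h,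
    ← h.commute_inv z, Equiv.Perm.mul_apply, Equiv.Perm.mul_apply, hzp, h.comm _ x] at h3
  exact ((L x).injective h3).symm

theorem inner_inv (h : IsCommAutLoop L e) (x y : Q) :
    (L (L (inv L e y) (inv L e x)))⁻¹ * (L (inv L e y) * L (inv L e x)) =
      (L (L y x))⁻¹ * (L y * L x) := by
  rw [inv_mul_eq_iff_eq_mul, ← h.inv_mul_distrib]
  ext u
  have h1 : L (L y x) (((L (L y x))⁻¹ * (L y * L x)) (inv L e u)) = L y (L x (inv L e u)) := by
    simp [Equiv.Perm.mul_apply]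
  have h2 := congrArg (inv L e) h1
  rw [(h.isAut_inner x y).map_inv h] at h2
  simp only [h.inv_mul_distrib, h.inv_inv] at h2
  rw [Equiv.Perm.mul_apply, Equiv.Perm.mul_apply, h.inv_mul_distrib]
  exact h2.symm

theorem P_one (h : IsCommAutLoop L e) (x : Q) : P L e x e = L x x := by
  have h1 : L (inv L e x) (L x x) = x := by
    have h2 := congrArg (fun f : Equiv.Perm Q => f x) (h.commute_inv x)
    simpa [h.inv_mul, h.mul_one_apply] using h2
  rw [P, Equiv.Perm.mul_apply, h.mul_one_apply, Equiv.Perm.inv_eq_iff_eq, h1]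

theorem P_inv (h : IsCommAutLoop L e) (x : Q) : P L e (inv L e x) = (P L e x)⁻¹ := by
  rw [P, P, h.inv_inv, mul_inv_rev, _root_.inv_inv]

theorem IsAut.map_P (h : IsCommAutLoop L e) {φ : Equiv.Perm Q} (hφ : IsAut L φ) (x : Q) :
    φ * P L e x = P L e (φ x) * φ := by
  have h1 := hφ (inv L e x)
  rw [hφ.map_inv h] at h1
  have h2 : φ * (L (inv L e x))⁻¹ = (L (inv L e (φ x)))⁻¹ * φ := by
    rw [eq_inv_mul_iff_mul_eq, ← mul_assoc, ← h1, mul_inv_cancel_right]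
  rw [P, P, ← mul_assoc, h2, mul_assoc, hφ x, mul_assoc]

/-- The automorphism `β` with `P_s = L_{s²} β`. -/
def sqTwist (L : Q → Equiv.Perm Q) (e s : Q) : Equiv.Perm Q :=
  (L s * L (inv L e s))⁻¹ * ((L (L s s))⁻¹ * (L s * L s))

theorem isAut_sqTwist (h : IsCommAutLoop L e) (s : Q) : IsAut L (sqTwist L e s) :=
  (h.isAut_mul_inv s).symm.mul (h.isAut_inner s s)

theorem sqTwist_inv (h : IsCommAutLoop L e) (s : Q) :
    sqTwist L e (inv L e s) = sqTwist L e s := by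
  rw [sqTwist, h.inner_inv, h.inv_inv, h.commute_inv, sqTwist]

theorem mul_sqTwist (h : IsCommAutLoop L e) (s : Q) :
    L (L s s) * sqTwist L e s = P L e s := by
  have hB := h.isAut_mul_inv s
  have hfix : (L s * L (inv L e s)) (L s s) = L s s := by
    rw [hB.map_mul, h.mul_inv_fixes]
  have hfix' : (L s * L (inv L e s))⁻¹ (L s s) = L s s := by
    rw [Equiv.Perm.inv_eq_iff_eq, hfix]
  have h1 := hB.symm.commute hfix'
  rw [sqTwist, ← mul_assoc, ← h1, mul_assoc, mul_inv_cancel_left, mul_inv_rev, P, mul_assoc,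
    inv_mul_cancel_left]

theorem mul_sq_sq (h : IsCommAutLoop L e) (x y : Q) :
    L (L x x) (L y y) = P L e x (P L e ((sqTwist L e x)⁻¹ y) e) := by
  rw [← h.mul_sqTwist x, h.P_one, Equiv.Perm.mul_apply, (h.isAut_sqTwist x).map_mul,
    apply_inv_apply]

theorem P_P_one (h : IsCommAutLoop L e) (x : Q) :
    P L e x (P L e x e) = L (L x x) (L x x) := by
  have hfix : sqTwist L e x x = x := by
    have h1 : ((L (L x x))⁻¹ * (L x * L x)) x = x := by
      rw [Equiv.Perm.mul_apply, Equiv.Perm.inv_eq_iff_eq, Equiv.Perm.mul_apply, h.comm (L x x)]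
    rw [sqTwist, Equiv.Perm.mul_apply, h1, Equiv.Perm.inv_eq_iff_eq, h.mul_inv_fixes]
  rw [h.mul_sq_sq, (Equiv.Perm.inv_eq_iff_eq).2 hfix.symm]

/-- If `P_a` commutes with every `P_x` then `sqTwist` is trivial in both directions. -/
theorem sqTwist_fixes (h : IsCommAutLoop L e) (hsq : Function.Injective fun x => L x x) {a : Q}
    (ha : ∀ x, P L e a * P L e x = P L e x * P L e a) (x : Q) :
    sqTwist L e x a = a ∧ sqTwist L e a x = x := by
  set v := (sqTwist L e x)⁻¹ a with hv_def
  set u := (sqTwist L e a)⁻¹ x with hu_def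
  have hx := (h.isAut_sqTwist x).symm
  have hv (y : Q) : P L e v * P L e y = P L e y * P L e v := by
    obtain ⟨w, rfl⟩ := (sqTwist L e x)⁻¹.surjective y
    have key := congrArg (fun f => (sqTwist L e x)⁻¹ * f) (ha w)
    simp only [← mul_assoc, hx.map_P h] at key
    simp only [mul_assoc, hx.map_P h] at key
    simp only [← mul_assoc] at key
    exact mul_right_cancel key
  have e1 : P L e a (P L e u e) = P L e x (P L e v e) := by
    rw [hu_def, hv_def, ← h.mul_sq_sq, ← h.mul_sq_sq, h.comm]
  have e2 : (P L e a)⁻¹ (P L e u e) = P L e x ((P L e v)⁻¹ e) := by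
    rw [hu_def, ← h.sqTwist_inv a, ← h.P_inv, ← h.mul_sq_sq, h.comm, h.mul_sq_sq, hx.map_inv h,
      h.P_inv]
  have ha' (x y : Q) : P L e a (P L e x y) = P L e x (P L e a y) :=
    congrArg (fun f : Equiv.Perm Q => f y) (ha x)
  have hv' (x y : Q) : P L e v (P L e x y) = P L e x (P L e v y) :=
    congrArg (fun f : Equiv.Perm Q => f y) (hv x)
  have e3 : P L e v (P L e u e) = P L e a (P L e x e) := by
    rw [Equiv.Perm.inv_eq_iff_eq] at e2
    rw [e2, ha', hv', hv', apply_inv_apply, ← ha']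
  have e4 : P L e a (P L e a e) = P L e v (P L e v e) := by
    apply (P L e x).injective
    rw [← ha', ← ha', ← e3, ← hv', e1, hv']
  have hva : v = a := by
    rw [h.P_P_one, h.P_P_one] at e4
    exact (hsq (hsq e4)).symm
  have hux : u = x := by
    rw [hva, ← ha'] at e1
    have e5 := (P L e a).injective e1
    rw [h.P_one, h.P_one] at e5
    exact hsq e5
  exact ⟨((Equiv.Perm.inv_eq_iff_eq).1 hva).symm, ((Equiv.Perm.inv_eq_iff_eq).1 hux).symm⟩

/-- If `P_a` commutes with every `P_x` then `L_{a²}` commutes with every translation. -/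
theorem sq_central (h : IsCommAutLoop L e) (hsq : Function.Bijective fun x => L x x) {a : Q}
    (ha : ∀ x, P L e a * P L e x = P L e x * P L e a) (x : Q) :
    L (L a a) * L x = L x * L (L a a) := by
  obtain ⟨s, rfl⟩ := hsq.2 x
  have hfix := h.sqTwist_fixes hsq.1 ha
  have hPa : L (L a a) = P L e a := by
    rw [← h.mul_sqTwist, left_eq_mul]
    ext y
    exact (hfix y).2
  have h1 := (h.isAut_sqTwist s).map_P h a
  rw [(hfix s).1] at h1
  rw [hPa]
  refine mul_right_cancel (b := sqTwist L e s) ?_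
  change P L e a * L (L s s) * _ = L (L s s) * P L e a * _
  rw [mul_assoc, mul_assoc, ← h1, ← mul_assoc (L (L s s)), h.mul_sqTwist, ha]

end IsCommAutLoop

/-- **Lemma 4.5.** In a uniquely 2-divisible commutative automorphic loop, if `a`
lies in the center of the associated Bruck loop (i.e. `P_a P_x = P_x P_a` for all
`x`, where `x⁻¹ := x \ 1` and `P_x(y) := x⁻¹ \ (x·y)`), then `a²` lies in the
center of `(Q,·)`: `(x·y)·a² = x·(y·a²)` for all `x, y`. -/
theorem bruck_central_sq_is_central
    (Q : Type) (mul ld : Q → Q → Q) (one : Q)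
    (hld1 : ∀ x y : Q, ld x (mul x y) = y)
    (hld2 : ∀ x y : Q, mul x (ld x y) = y)
    (hone1 : ∀ x : Q, mul one x = x)
    (hone2 : ∀ x : Q, mul x one = x)
    (hcomm : ∀ x y : Q, mul x y = mul y x)
    (hauto : ∀ x y u v : Q,
      ld (mul y x) (mul y (mul x (mul u v))) =
        mul (ld (mul y x) (mul y (mul x u))) (ld (mul y x) (mul y (mul x v))))
    (hsq : Function.Bijective (fun x : Q => mul x x))
    (a : Q)
    (ha : ∀ x y : Q, ld (ld a one) (mul a (ld (ld x one) (mul x y))) =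
      ld (ld x one) (mul x (ld (ld a one) (mul a y)))) :
    ∀ x y : Q, mul (mul x y) (mul a a) = mul x (mul y (mul a a)) := by
  intro x y
  let L : Q → Equiv.Perm Q := fun x => ⟨mul x, ld x, hld1 x, hld2 x⟩
  have h : IsCommAutLoop L one :=
    { one := Equiv.ext hone1
      comm := hcomm
      aut := fun x y u => Equiv.ext fun v => hauto x y u v }
  have hc := h.sq_central hsq (a := a) (fun z => Equiv.ext fun w => ha z w) x
  have hxy : mul (mul a a) (mul x y) = mul x (mul (mul a a) y) :=
    congrArg (fun f : Equiv.Perm Q => f y) hc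
  rw [hcomm, hxy, hcomm y]
end
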